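/- arXiv:1707.07349 — 7 statements merged into one kernel-verified Lean document; each statement's English description precedes it below -/
import Mathlib

section
/- Let φ : ℝⁿ × ℝᵐ → ℝ be C² and concave-convex. Then the gradient dynamics are pathwise stable: for any two solutions z(t) = (x(t),y(t)) and z′(t) = (x′(t),y′(t)) of ẋ = ∇ₓφ(x,y), ẏ = −∇_yφ(x,y), the Euclidean distance |z(t) − z′(t)| is non-increasing in t. -/
open scoped BigOperators

noncomputable section

/-- Points of `ℝⁿ × ℝᵐ`. -/
abbrev Pt (n m : ℕ) := (Fin n → ℝ) × (Fin m → ℝ)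

variable {n m : ℕ}

/-- The Euclidean distance on `ℝⁿ × ℝᵐ`. -/
def eDist (a b : Pt n m) : ℝ :=
  Real.sqrt (∑ i, (a.1 i - b.1 i) ^ 2 + ∑ j, (a.2 j - b.2 j) ^ 2)

/-- The Euclidean inner product on `ℝⁿ × ℝᵐ`. -/
def ip (a b : Pt n m) : ℝ := ∑ i, a.1 i * b.1 i + ∑ j, a.2 j * b.2 j

/-- `φ` is concave-convex: concave in `x` for each fixed `y`, convex in `y` for each fixed `x`. -/
def ConcaveConvex (φ : Pt n m → ℝ) : Prop :=
  (∀ y, ConcaveOn ℝ Set.univ fun x => φ (x, y)) ∧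
    (∀ x, ConvexOn ℝ Set.univ fun y => φ (x, y))

/-- `zb` is a saddle point of `φ`. -/
def IsSaddle (φ : Pt n m → ℝ) (zb : Pt n m) : Prop :=
  ∀ x y, φ (x, zb.2) ≤ φ zb ∧ φ zb ≤ φ (zb.1, y)

/-- The gradient of `φ` in the `x` variables. -/
def gradX (φ : Pt n m → ℝ) (z : Pt n m) : Fin n → ℝ :=
  fun i => fderiv ℝ φ z (Pi.single i 1, 0)

/-- The gradient of `φ` in the `y` variables. -/
def gradY (φ : Pt n m → ℝ) (z : Pt n m) : Fin m → ℝ :=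
  fun j => fderiv ℝ φ z (0, Pi.single j 1)

/-- `z : ℝ → ℝⁿ × ℝᵐ` is a (global, C¹) solution of the gradient dynamics
`ẋ = ∇ₓφ, ẏ = -∇_yφ`. -/
def IsSolution (φ : Pt n m → ℝ) (z : ℝ → Pt n m) : Prop :=
  ∀ t, HasDerivAt z (gradX φ (z t), -gradY φ (z t)) t

/-- `z ∈ 𝒮`: a solution of the gradient dynamics lying at constant distance
from every saddle point. -/
def InS (φ : Pt n m → ℝ) (z : ℝ → Pt n m) : Prop :=
  IsSolution φ z ∧ ∀ zb, IsSaddle φ zb → ∀ t, eDist (z t) zb = eDist (z 0) zb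

/-- Second directional derivative of `φ` at `z`, in directions `u` then `v`. -/
def hess (φ : Pt n m → ℝ) (z u v : Pt n m) : ℝ :=
  fderiv ℝ (fun w => fderiv ℝ φ w u) z v

/-- The `i`th coordinate direction in the `x` variables. -/
def ex (i : Fin n) : Pt n m := (Pi.single i 1, 0)

/-- The `j`th coordinate direction in the `y` variables. -/
def ey (j : Fin m) : Pt n m := (0, Pi.single j 1)

/-- The matrix `A(z) = [[0, φ_{xy}(z)], [-φ_{yx}(z), 0]]`. -/
def matA (φ : Pt n m → ℝ) (z : Pt n m) : Matrix (Fin n ⊕ Fin m) (Fin n ⊕ Fin m) ℝ :=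
  Matrix.fromBlocks 0 (Matrix.of fun i j => hess φ z (ex i) (ey j))
    (Matrix.of fun j i => -hess φ z (ey j) (ex i)) 0

/-- The matrix `B(z) = [[φ_{xx}(z), 0], [0, -φ_{yy}(z)]]`. -/
def matB (φ : Pt n m → ℝ) (z : Pt n m) : Matrix (Fin n ⊕ Fin m) (Fin n ⊕ Fin m) ℝ :=
  Matrix.fromBlocks (Matrix.of fun i i' => hess φ z (ex i) (ex i')) 0 0
    (Matrix.of fun j j' => -hess φ z (ey j) (ey j'))

/-- A point of `ℝⁿ × ℝᵐ` viewed as a vector indexed by `Fin n ⊕ Fin m`. -/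
def vec (z : Pt n m) : Fin n ⊕ Fin m → ℝ := Sum.elim z.1 z.2

/-- A vector indexed by `Fin n ⊕ Fin m` viewed as a point of `ℝⁿ × ℝᵐ`. -/
def unvec (v : Fin n ⊕ Fin m → ℝ) : Pt n m :=
  (fun i => v (Sum.inl i), fun j => v (Sum.inr j))

end

/-- A convex function lies above its tangents. -/
theorem ConvexOn.add_fderiv_le {E : Type*} [NormedAddCommGroup E] [NormedSpace ℝ E]
    {f : E → ℝ} (hf : ConvexOn ℝ Set.univ f) {f' : E →L[ℝ] ℝ} {a : E}
    (hd : HasFDerivAt f f' a) (b : E) : f a + f' (b - a) ≤ f b := by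
  have hline : HasDerivAt (AffineMap.lineMap a b : ℝ → E) (b - a) 0 :=
    AffineMap.hasDerivAt_lineMap
  have hconv : ConvexOn ℝ Set.univ (f ∘ (AffineMap.lineMap a b : ℝ →ᵃ[ℝ] E)) :=
    hf.comp_affineMap _
  have hderiv : HasDerivAt (f ∘ (AffineMap.lineMap a b : ℝ → E)) (f' (b - a)) 0 := by
    refine HasFDerivAt.comp_hasDerivAt (0 : ℝ) ?_ hline
    simpa using hd
  have h := hconv.le_slope_of_hasDerivAt (Set.mem_univ 0) (Set.mem_univ 1) one_pos hderiv
  simp [slope_def_field, -map_sub] at h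
  linarith

/-- A concave function lies below its tangents. -/
theorem ConcaveOn.le_add_fderiv {E : Type*} [NormedAddCommGroup E] [NormedSpace ℝ E]
    {f : E → ℝ} (hf : ConcaveOn ℝ Set.univ f) {f' : E →L[ℝ] ℝ} {a : E}
    (hd : HasFDerivAt f f' a) (b : E) : f b ≤ f a + f' (b - a) := by
  have h := hf.neg.add_fderiv_le hd.neg b
  simp at h
  simp only [map_sub]
  linarith

theorem fderiv_apply_left_eq_sum {n m : ℕ} (φ : Pt n m → ℝ) (z : Pt n m) (u : Fin n → ℝ) :
    fderiv ℝ φ z (u, 0) = ∑ i, u i * gradX φ z i := by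
  let L := (fderiv ℝ φ z).comp (ContinuousLinearMap.inl ℝ (Fin n → ℝ) (Fin m → ℝ))
  calc L u = L (∑ i, u i • Pi.single i 1) := by rw [← pi_eq_sum_univ']
    _ = ∑ i, u i * gradX φ z i := by simp only [map_sum, map_smul, smul_eq_mul]; rfl

theorem fderiv_apply_right_eq_sum {n m : ℕ} (φ : Pt n m → ℝ) (z : Pt n m) (v : Fin m → ℝ) :
    fderiv ℝ φ z (0, v) = ∑ j, v j * gradY φ z j := by
  let L := (fderiv ℝ φ z).comp (ContinuousLinearMap.inr ℝ (Fin n → ℝ) (Fin m → ℝ))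
  calc L v = L (∑ j, v j • Pi.single j 1) := by rw [← pi_eq_sum_univ']
    _ = ∑ j, v j * gradY φ z j := by simp only [map_sum, map_smul, smul_eq_mul]; rfl

/-- The vector field `(∇ₓφ, -∇_yφ)` of a concave-convex function is dissipative. -/
theorem ConcaveConvex.gradient_dissipative {n m : ℕ} {φ : Pt n m → ℝ} (hcc : ConcaveConvex φ)
    (hφ : Differentiable ℝ φ) (a b : Pt n m) :
    ∑ i, (a.1 i - b.1 i) * (gradX φ a i - gradX φ b i) +
      ∑ j, (a.2 j - b.2 j) * (-gradY φ a j + gradY φ b j) ≤ 0 := by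
  have hx (z : Pt n m) (x : Fin n → ℝ) :
      φ (x, z.2) ≤ φ z + ∑ i, (x i - z.1 i) * gradX φ z i := by
    have hd : HasFDerivAt (fun x => φ (x, z.2)) _ z.1 :=
      (hφ z).hasFDerivAt.comp z.1 (hasFDerivAt_prodMk_left z.1 z.2)
    simpa [fderiv_apply_left_eq_sum, -map_sub] using (hcc.1 z.2).le_add_fderiv hd x
  have hy (z : Pt n m) (y : Fin m → ℝ) :
      φ z + ∑ j, (y j - z.2 j) * gradY φ z j ≤ φ (z.1, y) := by
    have hd : HasFDerivAt (fun y => φ (z.1, y)) _ z.2 :=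
      (hφ z).hasFDerivAt.comp z.2 (hasFDerivAt_prodMk_right z.1 z.2)
    simpa [fderiv_apply_right_eq_sum, -map_sub] using (hcc.2 z.1).add_fderiv_le hd y
  have h₁ := hx a b.1
  have h₂ := hx b a.1
  have h₃ := hy a b.2
  have h₄ := hy b a.2
  simp only [sub_mul, mul_add, mul_sub, mul_neg, Finset.sum_add_distrib,
    Finset.sum_sub_distrib, Finset.sum_neg_distrib] at *
  linarith

/-- pathwise stability. For a `C²` concave-convex `φ`, the Euclidean
distance between any two solutions of the gradient dynamics is non-increasing in time. -/
theorem pathwise_stability {n m : ℕ} (φ : Pt n m → ℝ)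
    (hφ : ContDiff ℝ 2 φ) (hcc : ConcaveConvex φ)
    (z z' : ℝ → Pt n m) (hz : IsSolution φ z) (hz' : IsSolution φ z') :
    ∀ s t : ℝ, s ≤ t → eDist (z t) (z' t) ≤ eDist (z s) (z' s) := by
  have hX {w : ℝ → Pt n m} (hw : IsSolution φ w) (t : ℝ) (i : Fin n) :
      HasDerivAt (fun t => (w t).1 i) (gradX φ (w t) i) t :=
    hasDerivAt_pi.1 (hw t).fst i
  have hY {w : ℝ → Pt n m} (hw : IsSolution φ w) (t : ℝ) (j : Fin m) :
      HasDerivAt (fun t => (w t).2 j) (-gradY φ (w t) j) t :=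
    hasDerivAt_pi.1 (hw t).snd j
  have hderiv (t : ℝ) := (HasDerivAt.fun_sum fun i (_ : i ∈ Finset.univ) =>
      ((hX hz t i).fun_sub (hX hz' t i)).fun_pow 2).fun_add
    (HasDerivAt.fun_sum fun j (_ : j ∈ Finset.univ) =>
      ((hY hz t j).fun_sub (hY hz' t j)).fun_pow 2)
  have hanti := antitone_of_hasDerivAt_nonpos hderiv fun t => by
    have h := hcc.gradient_dissipative (hφ.differentiable two_ne_zero) (z t) (z' t)
    simp only [Pi.zero_apply, Nat.cast_ofNat, Nat.add_one_sub_one, pow_one, mul_assoc,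
      ← Finset.mul_sum, sub_neg_eq_add]
    linarith
  exact fun s t hst => Real.sqrt_le_sqrt (hanti hst)
end

section
/- Let φ : ℝⁿ × ℝᵐ → ℝ be C² and concave-convex, and suppose the set of saddle points of φ contains a bi-infinite line L = {a + s·b : s ∈ ℝ} for some a, b ∈ ℝⁿ × ℝᵐ. Then φ is translation invariant in the direction of L: φ(z) = φ(z + s·b) for every z ∈ ℝⁿ × ℝᵐ and every s ∈ ℝ. -/
open scoped BigOperators

/-- A continuous concave function bounded below on a line does not decrease along the direction
of that line, from any starting point. -/
theorem ConcaveOn.le_add_of_forall_le_line {E : Type*} [AddCommGroup E] [Module ℝ E]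
    [TopologicalSpace E] [ContinuousAdd E] [ContinuousSMul ℝ E] {f : E → ℝ}
    (hf : ConcaveOn ℝ Set.univ f) (hc : Continuous f) {a p : E} {c : ℝ}
    (h : ∀ s : ℝ, c ≤ f (a + s • p)) (x : E) : f x ≤ f (x + p) := by
  have hl : Filter.Tendsto (fun r : ℝ => (1 - r) * f x + r * c)
      (nhdsWithin 0 (Set.Ioi 0)) (nhds (f x)) := by
    have : Continuous fun r : ℝ => (1 - r) * f x + r * c := by fun_prop
    simpa using (this.tendsto 0).mono_left nhdsWithin_le_nhds
  have hr : Filter.Tendsto (fun r : ℝ => f ((1 - r) • x + r • a + p))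
      (nhdsWithin 0 (Set.Ioi 0)) (nhds (f (x + p))) := by
    have : Continuous fun r : ℝ => f ((1 - r) • x + r • a + p) := by fun_prop
    simpa using (this.tendsto 0).mono_left nhdsWithin_le_nhds
  refine le_of_tendsto_of_tendsto hl hr ?_
  filter_upwards [Ioo_mem_nhdsGT (zero_lt_one' ℝ)] with r hr
  have hpt : (1 - r) • x + r • (a + r⁻¹ • p) = (1 - r) • x + r • a + p := by
    rw [smul_add, smul_inv_smul₀ hr.1.ne', add_assoc]
  have hconc := hf.2 (Set.mem_univ x) (Set.mem_univ (a + r⁻¹ • p))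
    (sub_nonneg.2 hr.2.le) hr.1.le (sub_add_cancel 1 r)
  rw [hpt, smul_eq_mul, smul_eq_mul] at hconc
  exact (add_le_add_right (mul_le_mul_of_nonneg_left (h r⁻¹) hr.1.le) _).trans hconc

/-- A continuous concave function bounded below on a line is invariant along the direction
of that line. -/
theorem ConcaveOn.eq_add_smul_of_forall_le_line {E : Type*} [AddCommGroup E] [Module ℝ E]
    [TopologicalSpace E] [ContinuousAdd E] [ContinuousSMul ℝ E] {f : E → ℝ}
    (hf : ConcaveOn ℝ Set.univ f) (hc : Continuous f) {a p : E} {c : ℝ}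
    (h : ∀ s : ℝ, c ≤ f (a + s • p)) (x : E) (t : ℝ) : f x = f (x + t • p) := by
  have key (t : ℝ) (x : E) : f x ≤ f (x + t • p) :=
    hf.le_add_of_forall_le_line hc (p := t • p) (fun s => by simpa [smul_smul] using h (s * t)) x
  exact le_antisymm (key t x) (by simpa using key (-t) (x + t • p))

/-- All saddle points have the same value. -/
theorem IsSaddle.value_eq {n m : ℕ} {φ : Pt n m → ℝ} {z w : Pt n m}
    (hz : IsSaddle φ z) (hw : IsSaddle φ w) : φ z = φ w :=
  le_antisymm ((hz w.1 w.2).2.trans (hw z.1 z.2).1) ((hw z.1 z.2).2.trans (hz w.1 w.2).1)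

/-- If the saddle set of a `C²` concave-convex `φ` contains the bi-infinite
line `{a + s • b : s ∈ ℝ}`, then `φ` is translation invariant in the direction `b`. -/
theorem line_of_saddles_translation_invariance {n m : ℕ} (φ : Pt n m → ℝ)
    (hφ : ContDiff ℝ 2 φ) (hcc : ConcaveConvex φ)
    (a b : Pt n m) (hline : ∀ s : ℝ, IsSaddle φ (a + s • b)) :
    ∀ (z : Pt n m) (s : ℝ), φ z = φ (z + s • b) := by
  intro z s
  have hcont : Continuous φ := hφ.continuous
  have hval (t : ℝ) : φ (a + t • b) = φ a := by
    simpa using (hline t).value_eq (hline 0)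
  have hx : φ (z.1, z.2) = φ (z.1 + s • b.1, z.2) :=
    (hcc.1 z.2).eq_add_smul_of_forall_le_line (by fun_prop) (a := a.1) (c := φ a)
      (fun t => (hval t).ge.trans (hline t 0 z.2).2) z.1 s
  have hy : -φ (z.1 + s • b.1, z.2) = -φ (z.1 + s • b.1, z.2 + s • b.2) :=
    (hcc.2 (z.1 + s • b.1)).neg.eq_add_smul_of_forall_le_line
      (hcont.comp (by fun_prop)).neg (a := a.2) (c := -φ a)
      (fun t => neg_le_neg ((hline t (z.1 + s • b.1) 0).1.trans (hval t).le)) z.2 s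
  exact hx.trans (neg_injective hy)
end

section
/- Let φ : ℝⁿ × ℝᵐ → ℝ be C² and concave-convex, and let z(·) be a trajectory in S. Then for all t ∈ ℝ, z(t) lies in M_{S̄}(z(0)), the maximal orthogonal linear manifold to the saddle set S̄ through z(0). -/
open scoped BigOperators

/-- The square of the Euclidean distance on `ℝⁿ × ℝᵐ`. -/
theorem eDist_sq {n m : ℕ} (a b : Pt n m) :
    eDist a b ^ 2 = ∑ i, (a.1 i - b.1 i) ^ 2 + ∑ j, (a.2 j - b.2 j) ^ 2 :=
  Real.sq_sqrt (by positivity)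

/-- The polarization identity for the inner product of two differences. -/
theorem two_mul_ip_sub_sub {n m : ℕ} (a b u v : Pt n m) :
    2 * ip (a - b) (u - v) =
      (eDist a v ^ 2 - eDist a u ^ 2) - (eDist b v ^ 2 - eDist b u ^ 2) := by
  simp only [eDist_sq, ip, Prod.fst_sub, Prod.snd_sub, Pi.sub_apply]
  have key {k : ℕ} (a b u v : Fin k → ℝ) :
      2 * ∑ i, (a i - b i) * (u i - v i) =
        (∑ i, (a i - v i) ^ 2 - ∑ i, (a i - u i) ^ 2) -
          (∑ i, (b i - v i) ^ 2 - ∑ i, (b i - u i) ^ 2) := by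
    simp only [Finset.mul_sum, ← Finset.sum_sub_distrib]
    exact Finset.sum_congr rfl fun i _ => by ring
  linear_combination key a.1 b.1 u.1 v.1 + key a.2 b.2 u.2 v.2

/-- If `z ∈ 𝒮`, then `z(t)` stays in `M_{S̄}(z(0))`, the maximal orthogonal
linear manifold to the saddle set through `z(0)`; i.e. `z(t) - z(0)` is orthogonal to every
difference of saddle points. -/
theorem S_orthogonal_to_saddle_set {n m : ℕ} (φ : Pt n m → ℝ)
    (hφ : ContDiff ℝ 2 φ) (hcc : ConcaveConvex φ)
    (z : ℝ → Pt n m) (hz : InS φ z) :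
    ∀ t : ℝ, ∀ u u' : Pt n m, IsSaddle φ u → IsSaddle φ u' →
      ip (z t - z 0) (u - u') = 0 := by
  intro t u u' hu hu'
  have h := two_mul_ip_sub_sub (z t) (z 0) u u'
  rw [hz.2 u hu t, hz.2 u' hu' t] at h
  linarith
end

section
/- Let φ : ℝⁿ × ℝᵐ → ℝ be C² and concave-convex, let z̄ be a saddle point of φ, and let z(·) be a solution of the gradient dynamics such that |z(t) − z̄| is constant in t and z(t) ∈ M_{S̄}(z(0)) for all t. Then z(·) ∈ S, i.e. |z(t) − w̄| is constant in t for every saddle point w̄ of φ. -/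
open scoped BigOperators

/-- Moving the base point from `u` to `w` changes the squared distance to `a` by a function
that is affine in `a` with linear part `2 * ip a (u - w)`. -/
theorem sq_sum_sub_eq {n m : ℕ} (a b u w : Pt n m) :
    (∑ i, (a.1 i - w.1 i) ^ 2 + ∑ j, (a.2 j - w.2 j) ^ 2) -
        (∑ i, (b.1 i - w.1 i) ^ 2 + ∑ j, (b.2 j - w.2 j) ^ 2) =
      (∑ i, (a.1 i - u.1 i) ^ 2 + ∑ j, (a.2 j - u.2 j) ^ 2) -
        (∑ i, (b.1 i - u.1 i) ^ 2 + ∑ j, (b.2 j - u.2 j) ^ 2) + 2 * ip (a - b) (u - w) := by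
  have key : ∀ {k : ℕ} (a b u w : Fin k → ℝ),
      ∑ i, (a i - w i) ^ 2 - ∑ i, (b i - w i) ^ 2 =
        ∑ i, (a i - u i) ^ 2 - ∑ i, (b i - u i) ^ 2 + 2 * ∑ i, (a - b) i * (u - w) i := by
    intro k a b u w
    rw [Finset.mul_sum, ← Finset.sum_sub_distrib, ← Finset.sum_sub_distrib,
      ← Finset.sum_add_distrib]
    refine Finset.sum_congr rfl fun i _ => ?_
    simp only [Pi.sub_apply]
    ring
  simp only [ip, Prod.fst_sub, Prod.snd_sub]
  linarith [key a.1 b.1 u.1 w.1, key a.2 b.2 u.2 w.2]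

/-- If `z` is a solution of the gradient dynamics at constant distance from
one saddle point `zb`, and `z(t) ∈ M_{S̄}(z(0))` for all `t` (i.e. `z(t) - z(0)` is orthogonal
to every difference of saddle points), then `z` is at constant distance from every saddle
point, i.e. `z ∈ 𝒮`. -/
theorem orthogonal_and_constant_distance_implies_in_S {n m : ℕ} (φ : Pt n m → ℝ)
    (hφ : ContDiff ℝ 2 φ) (hcc : ConcaveConvex φ)
    (zb : Pt n m) (hzb : IsSaddle φ zb)
    (z : ℝ → Pt n m) (hz : IsSolution φ z)
    (hconst : ∀ t, eDist (z t) zb = eDist (z 0) zb)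
    (horth : ∀ t : ℝ, ∀ u u' : Pt n m, IsSaddle φ u → IsSaddle φ u' →
      ip (z t - z 0) (u - u') = 0) :
    ∀ wb, IsSaddle φ wb → ∀ t, eDist (z t) wb = eDist (z 0) wb := by
  intro wb hwb t
  have hsq := (Real.sqrt_inj (by positivity) (by positivity)).1 (hconst t)
  have hid := sq_sum_sub_eq (z t) (z 0) zb wb
  rw [horth t zb wb hzb hwb] at hid
  refine congrArg Real.sqrt ?_
  linarith
end

section
/- Let φ : ℝⁿ × ℝᵐ → ℝ be C² and concave-convex with at least one saddle point. Then S is convex: if z(·), z′(·) ∈ S and s ∈ [0,1], then the curve w(t) = s·z(t) + (1−s)·z′(t) is a solution of the gradient dynamics and belongs to S. -/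
open scoped BigOperators

/-- A convex function lies above its tangent hyperplanes. -/
theorem ConvexOn.add_apply_sub_le_of_hasFDerivAt {E : Type*} [NormedAddCommGroup E]
    [NormedSpace ℝ E] {f : E → ℝ} {f' : E →L[ℝ] ℝ} {a : E} (hf : ConvexOn ℝ Set.univ f)
    (hf' : HasFDerivAt f f' a) (b : E) : f a + f' (b - a) ≤ f b := by
  have hg : ConvexOn ℝ Set.univ (f ∘ AffineMap.lineMap (k := ℝ) a b) := by
    simpa using hf.comp_affineMap (AffineMap.lineMap (k := ℝ) a b)
  have hd : HasDerivAt (f ∘ AffineMap.lineMap (k := ℝ) a b) (f' (b - a)) 0 := by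
    have hl : HasDerivAt (AffineMap.lineMap (k := ℝ) a b) (b - a) (0 : ℝ) :=
      AffineMap.hasDerivAt_lineMap
    have hf'' : HasFDerivAt f f' (AffineMap.lineMap (k := ℝ) a b 0) := by simpa using hf'
    exact hf''.comp_hasDerivAt 0 hl
  have := hg.le_slope_of_hasDerivAt (Set.mem_univ 0) (Set.mem_univ 1) zero_lt_one hd
  simp only [slope_def_field, Function.comp_apply, AffineMap.lineMap_apply_zero,
    AffineMap.lineMap_apply_one, sub_zero, div_one] at this
  linarith

section Dissipative

open Filter Topology Bornology

variable {H : Type*} [NormedAddCommGroup H] [InnerProductSpace ℝ H] {G : H → H}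

theorem hasDerivAt_norm_sub_sq {z z' : ℝ → H} (hz : ∀ t, HasDerivAt z (G (z t)) t)
    (hz' : ∀ t, HasDerivAt z' (G (z' t)) t) (t : ℝ) :
    HasDerivAt (fun t => ‖z t - z' t‖ ^ 2) (2 * inner ℝ (z t - z' t) (G (z t) - G (z' t))) t :=
  ((hz t).sub (hz' t)).norm_sq

/-- Trajectories of a dissipative vector field approach each other. -/
theorem antitone_norm_sub_of_dissipative (hG : ∀ a b, inner ℝ (a - b) (G a - G b) ≤ 0)
    {z z' : ℝ → H} (hz : ∀ t, HasDerivAt z (G (z t)) t)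
    (hz' : ∀ t, HasDerivAt z' (G (z' t)) t) :
    Antitone fun t => ‖z t - z' t‖ := by
  have h := antitone_of_hasDerivAt_nonpos (hasDerivAt_norm_sub_sq hz hz')
    fun t => mul_nonpos_of_nonneg_of_nonpos zero_le_two (hG (z t) (z' t))
  intro a b hab
  exact (sq_le_sq₀ (norm_nonneg _) (norm_nonneg _)).1 (h hab)

/-- Bounded complete trajectories of a dissipative vector field are simultaneously recurrent in
backward time. -/
theorem exists_norm_sub_lt_of_dissipative [ProperSpace H]
    (hG : ∀ a b, inner ℝ (a - b) (G a - G b) ≤ 0) {z z' : ℝ → H}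
    (hz : ∀ t, HasDerivAt z (G (z t)) t) (hz' : ∀ t, HasDerivAt z' (G (z' t)) t)
    (hb : IsBounded (Set.range z)) (hb' : IsBounded (Set.range z')) {h : ℝ} (hh : 0 ≤ h)
    (t : ℝ) {ε : ℝ} (hε : 0 < ε) :
    ∃ r, h ≤ r ∧ ‖z t - z (t - r)‖ < ε ∧ ‖z' t - z' (t - r)‖ < ε := by
  obtain ⟨_, _, σ, hσ, hlim⟩ := tendsto_subseq_of_bounded (hb.prod hb')
    (x := fun k : ℕ => (z (t - k * h), z' (t - k * h))) fun k => by simp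
  obtain ⟨N, hN⟩ := Metric.cauchySeq_iff.1 hlim.cauchySeq ε hε
  have hd := hN N le_rfl (N + 1) (Nat.le_succ N)
  simp only [Function.comp_apply] at hd
  rw [Prod.dist_eq, max_lt_iff, dist_eq_norm, dist_eq_norm] at hd
  have hlt : ((σ N : ℝ) + 1) ≤ σ (N + 1) := by exact_mod_cast hσ (Nat.lt_succ_self N)
  have key : ∀ {y : ℝ → H}, (∀ t, HasDerivAt y (G (y t)) t) →
      ‖y t - y (t - ((σ (N + 1) : ℝ) - σ N) * h)‖ ≤
        ‖y (t - σ N * h) - y (t - σ (N + 1) * h)‖ := by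
    intro y hy
    have hy' : ∀ u, HasDerivAt (fun u => y (u - ((σ (N + 1) : ℝ) - σ N) * h))
        (G (y (u - ((σ (N + 1) : ℝ) - σ N) * h))) u := fun u => (hy _).comp_sub_const u _
    have := antitone_norm_sub_of_dissipative hG hy hy'
      (show t - σ N * h ≤ t from sub_le_self _ (by positivity))
    refine this.trans_eq ?_
    simp only
    congr 3
    ring
  exact ⟨((σ (N + 1) : ℝ) - σ N) * h, by nlinarith, (key hz).trans_lt hd.1,
    (key hz').trans_lt hd.2⟩

/-- Bounded complete trajectories of a dissipative vector field keep a constant distance. -/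
theorem norm_sub_eq_of_dissipative [ProperSpace H]
    (hG : ∀ a b, inner ℝ (a - b) (G a - G b) ≤ 0) {z z' : ℝ → H}
    (hz : ∀ t, HasDerivAt z (G (z t)) t) (hz' : ∀ t, HasDerivAt z' (G (z' t)) t)
    (hb : IsBounded (Set.range z)) (hb' : IsBounded (Set.range z')) (t u : ℝ) :
    ‖z t - z' t‖ = ‖z u - z' u‖ := by
  wlog htu : t ≤ u generalizing t u
  · exact (this u t (le_of_not_ge htu)).symm
  have hanti := antitone_norm_sub_of_dissipative hG hz hz'
  refine le_antisymm (le_of_forall_pos_le_add fun ε hε => ?_) (hanti htu)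
  obtain ⟨r, hr, h₁, h₂⟩ := exists_norm_sub_lt_of_dissipative hG hz hz' hb hb'
    (sub_nonneg.2 htu) u (half_pos hε)
  have h₃ : ‖z t - z' t‖ ≤ ‖z (u - r) - z' (u - r)‖ := hanti (by linarith)
  have h₄ : ‖z (u - r) - z' (u - r)‖ ≤
      ‖z (u - r) - z u‖ + ‖z u - z' u‖ + ‖z' u - z' (u - r)‖ := by
    simpa only [dist_eq_norm] using dist_triangle4 (z (u - r)) (z u) (z' u) (z' (u - r))
  rw [norm_sub_rev (z (u - r)) (z u)] at h₄
  linarith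

/-- Minty's trick: a vector which may be added to the graph of a continuous vector field `G` at `w`
without violating dissipativity is `G w`. -/
theorem eq_of_forall_inner_nonpos (hc : Continuous G) {w c : H}
    (h : ∀ v, inner ℝ (v - w) (G v - c) ≤ 0) : G w = c := by
  set d := G w - c with hd
  have hlim : Tendsto (fun ε : ℝ => inner ℝ d (G (w + ε • d) - c)) (𝓝[>] 0)
      (𝓝 (inner ℝ d d)) := by
    have : Continuous fun ε : ℝ => inner ℝ d (G (w + ε • d) - c) := by fun_prop
    simpa [hd] using (this.tendsto 0).mono_left nhdsWithin_le_nhds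
  have hle : inner ℝ d d ≤ 0 := by
    refine le_of_tendsto hlim ?_
    filter_upwards [self_mem_nhdsWithin] with ε (hε : 0 < ε)
    have := h (w + ε • d)
    rw [add_sub_cancel_left, real_inner_smul_left] at this
    exact nonpos_of_mul_nonpos_right this hε
  rw [real_inner_self_eq_norm_sq] at hle
  exact sub_eq_zero.1 (norm_eq_zero.1 (pow_eq_zero_iff two_ne_zero |>.1
    (hle.antisymm (sq_nonneg _))))

/-- A continuous dissipative vector field is affine on a segment whose endpoints it does not bring
closer. -/
theorem apply_convex_comb_of_dissipative (hc : Continuous G)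
    (hG : ∀ a b, inner ℝ (a - b) (G a - G b) ≤ 0) {a b : H} (hab : inner ℝ (a - b) (G a - G b) = 0)
    {s : ℝ} (hs : s ∈ Set.Icc (0 : ℝ) 1) :
    G (s • a + (1 - s) • b) = s • G a + (1 - s) • G b := by
  refine eq_of_forall_inner_nonpos hc fun v => ?_
  have h₁ := mul_nonpos_of_nonneg_of_nonpos hs.1 (hG v a)
  have h₂ := mul_nonpos_of_nonneg_of_nonpos (sub_nonneg.2 hs.2) (hG v b)
  have h₃ : inner ℝ (v - (s • a + (1 - s) • b)) (G v - (s • G a + (1 - s) • G b)) =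
      s * inner ℝ (v - a) (G v - G a) + (1 - s) * inner ℝ (v - b) (G v - G b)
        - s * (1 - s) * inner ℝ (a - b) (G a - G b) := by
    simp only [inner_sub_left, inner_sub_right, inner_add_left, inner_add_right,
      real_inner_smul_left, real_inner_smul_right]
    ring
  rw [h₃, hab]
  linarith

theorem norm_convex_comb_sub_sq (a b c : H) (s : ℝ) :
    ‖s • a + (1 - s) • b - c‖ ^ 2 =
      s * ‖a - c‖ ^ 2 + (1 - s) * ‖b - c‖ ^ 2 - s * (1 - s) * ‖a - b‖ ^ 2 := by
  simp only [← real_inner_self_eq_norm_sq, inner_sub_left, inner_sub_right, inner_add_left,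
    inner_add_right, real_inner_smul_left, real_inner_smul_right, real_inner_comm a b,
    real_inner_comm a c, real_inner_comm b c]
  ring

/-- Convex combinations of bounded complete trajectories of a continuous dissipative vector field
are trajectories. -/
theorem hasDerivAt_convex_comb_of_dissipative [ProperSpace H] (hc : Continuous G)
    (hG : ∀ a b, inner ℝ (a - b) (G a - G b) ≤ 0) {z z' : ℝ → H}
    (hz : ∀ t, HasDerivAt z (G (z t)) t) (hz' : ∀ t, HasDerivAt z' (G (z' t)) t)
    (hb : IsBounded (Set.range z)) (hb' : IsBounded (Set.range z'))
    {s : ℝ} (hs : s ∈ Set.Icc (0 : ℝ) 1) (t : ℝ) :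
    HasDerivAt (fun t => s • z t + (1 - s) • z' t) (G (s • z t + (1 - s) • z' t)) t := by
  have hconst : (fun t => ‖z t - z' t‖ ^ 2) = fun _ => ‖z 0 - z' 0‖ ^ 2 :=
    funext fun u => by rw [norm_sub_eq_of_dissipative hG hz hz' hb hb' u 0]
  have h₀ := hasDerivAt_norm_sub_sq hz hz' t
  rw [hconst] at h₀
  have h₁ := h₀.unique (hasDerivAt_const t _)
  rw [apply_convex_comb_of_dissipative hc hG (by linarith) hs]
  exact ((hz t).const_smul s).add ((hz' t).const_smul (1 - s))

end Dissipative

section Euclidean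

variable {n m : ℕ}

/-- `ℝⁿ × ℝᵐ` identified with the Euclidean space of dimension `n + m`. -/
noncomputable def ptEquiv : Pt n m ≃L[ℝ] EuclideanSpace ℝ (Fin n ⊕ Fin m) :=
  ((LinearEquiv.sumArrowLequivProdArrow (Fin n) (Fin m) ℝ ℝ).symm ≪≫ₗ
    (WithLp.linearEquiv 2 ℝ (Fin n ⊕ Fin m → ℝ)).symm).toContinuousLinearEquiv

theorem ptEquiv_apply_inl (a : Pt n m) (i : Fin n) : ptEquiv a (Sum.inl i) = a.1 i :=
  rfl

theorem ptEquiv_apply_inr (a : Pt n m) (j : Fin m) : ptEquiv a (Sum.inr j) = a.2 j :=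
  rfl

theorem inner_ptEquiv (a b : Pt n m) : inner ℝ (ptEquiv a) (ptEquiv b) = ip a b := by
  simp [PiLp.inner_apply, ip, ptEquiv_apply_inl, ptEquiv_apply_inr, mul_comm]

theorem eDist_eq_norm (a b : Pt n m) : eDist a b = ‖ptEquiv a - ptEquiv b‖ := by
  simp [EuclideanSpace.norm_eq, eDist, ptEquiv_apply_inl, ptEquiv_apply_inr]

end Euclidean

section Gradient

variable {n m : ℕ} {φ : Pt n m → ℝ}

/-- The vector field of the gradient dynamics. -/
noncomputable def gradField (φ : Pt n m → ℝ) (z : Pt n m) : Pt n m := (gradX φ z, -gradY φ z)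

theorem continuous_gradField (hφ : ContDiff ℝ 2 φ) : Continuous (gradField φ) := by
  have h : Continuous (fderiv ℝ φ) := hφ.continuous_fderiv two_ne_zero
  unfold gradField gradX gradY
  fun_prop

theorem fderiv_apply_inl (φ : Pt n m → ℝ) (z : Pt n m) (v : Fin n → ℝ) :
    fderiv ℝ φ z (v, 0) = ∑ i, v i * gradX φ z i := by
  have h := map_sum ((fderiv ℝ φ z).comp (.inl ℝ (Fin n → ℝ) (Fin m → ℝ)))
    (fun i => v i • Pi.single i (1 : ℝ)) Finset.univ
  rw [← pi_eq_sum_univ' v] at h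
  simpa [gradX] using h

theorem fderiv_apply_inr (φ : Pt n m → ℝ) (z : Pt n m) (v : Fin m → ℝ) :
    fderiv ℝ φ z (0, v) = ∑ j, v j * gradY φ z j := by
  have h := map_sum ((fderiv ℝ φ z).comp (.inr ℝ (Fin n → ℝ) (Fin m → ℝ)))
    (fun j => v j • Pi.single j (1 : ℝ)) Finset.univ
  rw [← pi_eq_sum_univ' v] at h
  simpa [gradY] using h

theorem ip_gradField (φ : Pt n m → ℝ) (v z : Pt n m) :
    ip v (gradField φ z) = fderiv ℝ φ z (v.1, 0) - fderiv ℝ φ z (0, v.2) := by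
  simp [fderiv_apply_inl, fderiv_apply_inr, ip, gradField, sub_eq_add_neg]

theorem ConcaveConvex.le_add_fderiv (hcc : ConcaveConvex φ) (hφ : Differentiable ℝ φ)
    (a : Pt n m) (x : Fin n → ℝ) : φ (x, a.2) ≤ φ a + fderiv ℝ φ a (x - a.1, 0) := by
  have hd : HasFDerivAt (fun x => φ (x, a.2))
      ((fderiv ℝ φ a).comp (.inl ℝ (Fin n → ℝ) (Fin m → ℝ))) a.1 :=
    (hφ a).hasFDerivAt.comp a.1 (hasFDerivAt_prodMk_left a.1 a.2)
  have h := (hcc.1 a.2).neg.add_apply_sub_le_of_hasFDerivAt hd.neg x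
  simp at h
  linarith

theorem ConcaveConvex.add_fderiv_le (hcc : ConcaveConvex φ) (hφ : Differentiable ℝ φ)
    (a : Pt n m) (y : Fin m → ℝ) : φ a + fderiv ℝ φ a (0, y - a.2) ≤ φ (a.1, y) := by
  have hd : HasFDerivAt (fun y => φ (a.1, y))
      ((fderiv ℝ φ a).comp (.inr ℝ (Fin n → ℝ) (Fin m → ℝ))) a.2 :=
    (hφ a).hasFDerivAt.comp a.2 (hasFDerivAt_prodMk_right a.1 a.2)
  simpa using (hcc.2 a.1).add_apply_sub_le_of_hasFDerivAt hd y

theorem ConcaveConvex.ip_gradField_sub_nonpos (hcc : ConcaveConvex φ) (hφ : Differentiable ℝ φ)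
    (a b : Pt n m) : ip (a - b) (gradField φ a - gradField φ b) ≤ 0 := by
  have h : ip (a - b) (gradField φ a - gradField φ b) =
      -ip (b - a) (gradField φ a) - ip (a - b) (gradField φ b) := by
    simp only [← inner_ptEquiv, map_sub, inner_sub_left, inner_sub_right]
    ring
  rw [h, ip_gradField, ip_gradField]
  have h₁ := hcc.le_add_fderiv hφ a b.1
  have h₂ := hcc.le_add_fderiv hφ b a.1
  have h₃ := hcc.add_fderiv_le hφ a b.2
  have h₄ := hcc.add_fderiv_le hφ b a.2
  simp only [Prod.fst_sub, Prod.snd_sub]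
  linarith

/-- The vector field of the gradient dynamics, on Euclidean space. -/
noncomputable def euclideanGradField (φ : Pt n m → ℝ) (v : EuclideanSpace ℝ (Fin n ⊕ Fin m)) :
    EuclideanSpace ℝ (Fin n ⊕ Fin m) :=
  ptEquiv (gradField φ (ptEquiv.symm v))

theorem isSolution_iff_ptEquiv {z : ℝ → Pt n m} :
    IsSolution φ z ↔ ∀ t, HasDerivAt (fun t => ptEquiv (z t))
      (euclideanGradField φ (ptEquiv (z t))) t := by
  refine forall_congr' fun t => ⟨fun h => ?_, fun h => ?_⟩
  · have h' := (ptEquiv (n := n) (m := m)).hasFDerivAt.comp_hasDerivAt t h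
    simp only [euclideanGradField, ContinuousLinearEquiv.symm_apply_apply]
    exact h'
  · have h' := (ptEquiv (n := n) (m := m)).symm.hasFDerivAt.comp_hasDerivAt t h
    simp only [euclideanGradField, Function.comp_def, ContinuousLinearEquiv.coe_coe,
      ContinuousLinearEquiv.symm_apply_apply] at h'
    exact h'

theorem InS.isBounded_range {z : ℝ → Pt n m} (hz : InS φ z) {zb : Pt n m} (hzb : IsSaddle φ zb) :
    Bornology.IsBounded (Set.range fun t => ptEquiv (z t)) := by
  refine (Metric.isBounded_closedBall (x := ptEquiv zb)
    (r := eDist (z 0) zb)).subset (Set.range_subset_iff.2 fun t => ?_)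
  rw [Metric.mem_closedBall, dist_eq_norm, ← eDist_eq_norm, hz.2 zb hzb t]

end Gradient

/-- `𝒮` is convex: the pointwise convex combination of two trajectories in
`𝒮` is a solution of the gradient dynamics and belongs to `𝒮`. -/
theorem S_is_convex {n m : ℕ} (φ : Pt n m → ℝ)
    (hφ : ContDiff ℝ 2 φ) (hcc : ConcaveConvex φ)
    (hsaddle : ∃ zb, IsSaddle φ zb)
    (z z' : ℝ → Pt n m) (hz : InS φ z) (hz' : InS φ z')
    (s : ℝ) (hs : s ∈ Set.Icc (0 : ℝ) 1) :
    IsSolution φ (fun t => s • z t + (1 - s) • z' t) ∧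
      InS φ (fun t => s • z t + (1 - s) • z' t) := by
  obtain ⟨z₀, hz₀⟩ := hsaddle
  have hsol := isSolution_iff_ptEquiv.1 hz.1
  have hsol' := isSolution_iff_ptEquiv.1 hz'.1
  have hb := hz.isBounded_range hz₀
  have hb' := hz'.isBounded_range hz₀
  have hc : Continuous (euclideanGradField φ) :=
    ptEquiv.continuous.comp
      ((continuous_gradField hφ).comp ptEquiv.symm.continuous)
  have hG : ∀ a b, inner ℝ (a - b) (euclideanGradField φ a - euclideanGradField φ b) ≤ 0 := by
    intro a b
    have := hcc.ip_gradField_sub_nonpos (hφ.differentiable two_ne_zero)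
      (ptEquiv.symm a) (ptEquiv.symm b)
    rw [← inner_ptEquiv] at this
    simpa [euclideanGradField] using this
  have hw : IsSolution φ fun t => s • z t + (1 - s) • z' t := by
    rw [isSolution_iff_ptEquiv]
    simpa only [map_add, map_smul] using
      hasDerivAt_convex_comb_of_dissipative hc hG hsol hsol' hb hb' hs
  refine ⟨hw, hw, fun zb hzb t => ?_⟩
  have h₁ := hz.2 zb hzb t
  have h₂ := hz'.2 zb hzb t
  have h₃ := norm_sub_eq_of_dissipative hG hsol hsol' hb hb' t 0
  simp only [eDist_eq_norm, map_add, map_smul] at h₁ h₂ ⊢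
  rw [← sq_eq_sq₀ (norm_nonneg _) (norm_nonneg _), norm_convex_comb_sub_sq,
    norm_convex_comb_sub_sq, h₁, h₂, h₃]
end

section
/- Let φ : ℝⁿ × ℝᵐ → ℝ be C² and concave-convex, and assume 0 is a saddle point of φ. Then every trajectory z(·) ∈ S solves the linear ODE ż(t) = A(0)·z(t). Moreover, a solution z(·) of ż(t) = A(0)·z(t) belongs to S if and only if for all t ∈ ℝ and all r ∈ [0,1], z(t) ∈ ker(B(r·z(t))) ∩ ker(A(r·z(t)) − A(0)). -/
open scoped BigOperators

section Abstract
variable {E F : Type*} [NormedAddCommGroup E] [NormedSpace ℝ E]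
  [NormedAddCommGroup F] [NormedSpace ℝ F]

theorem ConvexOn.add_fderiv_sub_le {g : E → ℝ} (hg : ConvexOn ℝ Set.univ g) {g' : E →L[ℝ] ℝ}
    {x : E} (hd : HasFDerivAt g g' x) (w : E) : g x + g' (w - x) ≤ g w := by
  have hc : ConvexOn ℝ Set.univ (g ∘ AffineMap.lineMap (k := ℝ) x w) := by
    simpa using hg.comp_affineMap (AffineMap.lineMap (k := ℝ) x w)
  have hl : HasDerivAt (AffineMap.lineMap (k := ℝ) x w) (w - x) 0 :=
    AffineMap.hasDerivAt_lineMap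
  have hd' : HasFDerivAt g g' (AffineMap.lineMap (k := ℝ) x w 0) := by simpa using hd
  have h := hc.le_slope_of_hasDerivAt (Set.mem_univ 0) (Set.mem_univ 1) one_pos
    (hd'.comp_hasDerivAt (0 : ℝ) hl)
  simp [slope] at h
  rw [map_sub]
  linarith

theorem ConcaveOn.le_add_fderiv_sub {g : E → ℝ} (hg : ConcaveOn ℝ Set.univ g) {g' : E →L[ℝ] ℝ}
    {x : E} (hd : HasFDerivAt g g' x) (w : E) : g w ≤ g x + g' (w - x) := by
  have := hg.neg.add_fderiv_sub_le hd.neg w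
  simp at this ⊢
  linarith

/-- If a concave-convex function has a saddle point at the origin and the saddle inequality
`⟪z, (∇ₓ f, -∇_y f)⟫ ≤ 0` is an equality at `(x, y)`, then the partial gradient in the first
variable is linear in `s` on the rectangle spanned by `(r x, s y)`. -/
theorem fderiv_fst_eq_of_saddle {f : E × F → ℝ} (hf : Differentiable ℝ f)
    (hx : ∀ y, ConcaveOn ℝ Set.univ fun x => f (x, y))
    (hy : ∀ x, ConvexOn ℝ Set.univ fun y => f (x, y))
    (h0 : ∀ x y, f (x, 0) ≤ f (0, 0) ∧ f (0, 0) ≤ f (0, y)) {x : E} {y : F}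
    (hxy : 0 ≤ fderiv ℝ f (x, y) (x, -y)) {r s : ℝ} (hr : r ∈ Set.Icc (0 : ℝ) 1)
    (hs : s ∈ Set.Icc (0 : ℝ) 1) (u : E) :
    fderiv ℝ f (r • x, s • y) (u, 0) = s * fderiv ℝ f (x, y) (u, 0) := by
  obtain ⟨hr0, hr1⟩ := hr
  obtain ⟨hs0, hs1⟩ := hs
  have d1 : ∀ a b, HasFDerivAt (fun x => f (x, b))
      ((fderiv ℝ f (a, b)).comp (ContinuousLinearMap.inl ℝ E F)) a := fun a b =>
    (hf (a, b)).hasFDerivAt.comp a (hasFDerivAt_prodMk_left a b)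
  have d2 : ∀ a b, HasFDerivAt (fun y => f (a, y))
      ((fderiv ℝ f (a, b)).comp (ContinuousLinearMap.inr ℝ E F)) b := fun a b =>
    (hf (a, b)).hasFDerivAt.comp b (hasFDerivAt_prodMk_right a b)
  have tx : ∀ w, f (w, y) ≤ f (x, y) + fderiv ℝ f (x, y) (w, 0) - fderiv ℝ f (x, y) (x, 0) := by
    intro w
    have := (hx y).le_add_fderiv_sub (d1 x y) w
    simp only [map_sub, ContinuousLinearMap.comp_apply, ContinuousLinearMap.inl_apply] at this
    linarith
  have ty : ∀ w, f (x, y) + fderiv ℝ f (x, y) (0, w) - fderiv ℝ f (x, y) (0, y) ≤ f (x, w) := by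
    intro w
    have := (hy x).add_fderiv_sub_le (d2 x y) w
    simp only [map_sub, ContinuousLinearMap.comp_apply, ContinuousLinearMap.inr_apply] at this
    linarith
  have cx : ∀ b, ∀ t, 0 ≤ t → t ≤ 1 → (1 - t) * f (0, b) + t * f (x, b) ≤ f (t • x, b) := by
    intro b t h0 h1
    simpa using (hx b).2 (Set.mem_univ 0) (Set.mem_univ x) (sub_nonneg.2 h1) h0 (by ring)
  have cy : ∀ a, ∀ t, 0 ≤ t → t ≤ 1 → f (a, t • y) ≤ (1 - t) * f (a, 0) + t * f (a, y) := by
    intro a t h0 h1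
    simpa using (hy a).2 (Set.mem_univ 0) (Set.mem_univ y) (sub_nonneg.2 h1) h0 (by ring)
  have split : fderiv ℝ f (x, y) (x, -y)
      = fderiv ℝ f (x, y) (x, 0) - fderiv ℝ f (x, y) (0, y) := by
    rw [← map_sub]; simp
  have e1 := tx 0
  have e2 := ty 0
  have z0 : fderiv ℝ f (x, y) ((0 : E), (0 : F)) = 0 := map_zero _
  rw [z0] at e1 e2
  have s1 := (h0 x y).1
  have s2 := (h0 x y).2
  have f_x_zero : f (x, 0) = f (0, 0) := by linarith
  have f_zero_y : f (0, y) = f (0, 0) := by linarith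
  have Dx : fderiv ℝ f (x, y) (x, 0) = f (x, y) - f (0, 0) := by linarith
  have Dy : fderiv ℝ f (x, y) (0, y) = f (x, y) - f (0, 0) := by linarith
  have smulx : fderiv ℝ f (x, y) (r • x, 0) = r * fderiv ℝ f (x, y) (x, 0) := by
    rw [← smul_eq_mul, ← map_smul]; simp
  have smuly : fderiv ℝ f (x, y) (0, s • y) = s * fderiv ℝ f (x, y) (0, y) := by
    rw [← smul_eq_mul, ← map_smul]; simp
  have f_rx_zero : f (r • x, 0) = f (0, 0) := by
    have := cx 0 r hr0 hr1
    have := (h0 (r • x) y).1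
    rw [f_x_zero] at *
    linarith
  have f_zero_sy : f (0, s • y) = f (0, 0) := by
    have := cy 0 s hs0 hs1
    have := (h0 x (s • y)).2
    rw [f_zero_y] at *
    linarith
  have frxy : f (r • x, y) = f (0, 0) + r * (f (x, y) - f (0, 0)) := by
    have := cx y r hr0 hr1
    have := tx (r • x)
    rw [smulx, Dx] at this
    rw [f_zero_y] at *
    linarith
  have fxsy : f (x, s • y) = f (0, 0) + s * (f (x, y) - f (0, 0)) := by
    have := cy x s hs0 hs1
    have := ty (s • y)
    rw [smuly, Dy] at this
    rw [f_x_zero] at *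
    linarith
  have frs : f (r • x, s • y) = (1 - s) * f (r • x, 0) + s * f (r • x, y) := by
    have h1 := cx (s • y) r hr0 hr1
    have h2 := cy (r • x) s hs0 hs1
    refine le_antisymm h2 ?_
    rw [f_zero_sy, fxsy] at h1
    rw [f_rx_zero, frxy]
    linarith
  have grad0 : fderiv ℝ f (r • x, 0) (u, 0) = 0 := by
    have hmax : IsLocalMax (fun w => f (w, 0)) (r • x) :=
      Filter.Eventually.of_forall fun w => by simpa [f_rx_zero] using (h0 w y).1
    simpa using DFunLike.congr_fun (hmax.hasFDerivAt_eq_zero (d1 (r • x) 0)) u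
  have grad1 : fderiv ℝ f (r • x, y) (u, 0) = fderiv ℝ f (x, y) (u, 0) := by
    have hmax : IsLocalMax (fun w => f (w, y) - fderiv ℝ f (x, y) (w, 0)) (r • x) :=
      Filter.Eventually.of_forall fun w => by
        have := tx w
        simp only [smulx, Dx, frxy] at *
        linarith
    have hd := (d1 (r • x) y).sub
      ((fderiv ℝ f (x, y)).comp (ContinuousLinearMap.inl ℝ E F)).hasFDerivAt
    have := DFunLike.congr_fun (hmax.hasFDerivAt_eq_zero hd) u
    simp at this
    linarith
  have hmin : IsLocalMin (fun w => (1 - s) * f (w, 0) + s * f (w, y) - f (w, s • y)) (r • x) :=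
    Filter.Eventually.of_forall fun w => by
      have := cy w s hs0 hs1
      simp only [frs]
      linarith
  have hd := (((d1 (r • x) 0).const_mul (1 - s)).add ((d1 (r • x) y).const_mul s)).sub
    (d1 (r • x) (s • y))
  have := DFunLike.congr_fun (hmin.hasFDerivAt_eq_zero hd) u
  simp [grad0, grad1] at this
  linarith

/-- The counterpart of `fderiv_fst_eq_of_saddle` for the second variable. -/
theorem fderiv_snd_eq_of_saddle {f : E × F → ℝ} (hf : Differentiable ℝ f)
    (hx : ∀ y, ConcaveOn ℝ Set.univ fun x => f (x, y))
    (hy : ∀ x, ConvexOn ℝ Set.univ fun y => f (x, y))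
    (h0 : ∀ x y, f (x, 0) ≤ f (0, 0) ∧ f (0, 0) ≤ f (0, y)) {x : E} {y : F}
    (hxy : 0 ≤ fderiv ℝ f (x, y) (x, -y)) {r s : ℝ} (hr : r ∈ Set.Icc (0 : ℝ) 1)
    (hs : s ∈ Set.Icc (0 : ℝ) 1) (v : F) :
    fderiv ℝ f (r • x, s • y) (0, v) = r * fderiv ℝ f (x, y) (0, v) := by
  have hd : ∀ p : F × E, HasFDerivAt (fun q : F × E => -f q.swap)
      (-(fderiv ℝ f p.swap).comp
        (ContinuousLinearEquiv.prodComm ℝ F E : F × E →L[ℝ] E × F)) p := fun p =>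
    ((hf p.swap).hasFDerivAt.comp p
      (ContinuousLinearEquiv.prodComm ℝ F E : F × E →L[ℝ] E × F).hasFDerivAt).neg
  have key := fderiv_fst_eq_of_saddle (f := fun q : F × E => -f q.swap) (x := y) (y := x)
    (fun p => (hd p).differentiableAt) (fun a => (hy a).neg) (fun b => (hx b).neg)
    (fun b a => by simpa using (h0 a b).symm)
    (by
      rw [(hd _).fderiv]
      have : ((-x, y) : E × F) = -(x, -y) := by simp
      change 0 ≤ -(fderiv ℝ f (x, y) (-x, y))
      rwa [this, map_neg, neg_neg]) hs hr v
  rw [(hd _).fderiv, (hd _).fderiv] at key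
  simpa using key

/-- A saddle point `(a, b)` of a concave-convex function `f` satisfies
`⟪z - (a, b), (∇ₓ f z, -∇_y f z)⟫ ≤ 0` for every `z`. -/
theorem fderiv_nonpos_of_saddle {f : E × F → ℝ} (hf : Differentiable ℝ f)
    (hx : ∀ y, ConcaveOn ℝ Set.univ fun x => f (x, y))
    (hy : ∀ x, ConvexOn ℝ Set.univ fun y => f (x, y)) {a : E} {b : F}
    (h : ∀ x y, f (x, b) ≤ f (a, b) ∧ f (a, b) ≤ f (a, y)) (x : E) (y : F) :
    fderiv ℝ f (x, y) (x - a, -(y - b)) ≤ 0 := by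
  have e1 := (hx y).le_add_fderiv_sub
    ((hf (x, y)).hasFDerivAt.comp x (hasFDerivAt_prodMk_left x y)) a
  have e2 := (hy x).add_fderiv_sub_le
    ((hf (x, y)).hasFDerivAt.comp y (hasFDerivAt_prodMk_right x y)) b
  simp only [ContinuousLinearMap.comp_apply, ContinuousLinearMap.inl_apply,
    ContinuousLinearMap.inr_apply] at e1 e2
  have e3 : fderiv ℝ f (x, y) (x - a, -(y - b))
      = fderiv ℝ f (x, y) (0, b - y) - fderiv ℝ f (x, y) (a - x, 0) := by
    rw [← map_sub]; simp
  have := h x y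
  linarith

end Abstract

section InnerProduct
variable {n m : ℕ}

theorem ip_comm (a b : Pt n m) : ip a b = ip b a := by
  simp only [ip, mul_comm]

theorem ip_sub_left (a b c : Pt n m) : ip (a - b) c = ip a c - ip b c := by
  simp only [ip, Prod.fst_sub, Prod.snd_sub, Pi.sub_apply, sub_mul, Finset.sum_sub_distrib]
  ring

theorem ip_sub_right (a b c : Pt n m) : ip a (b - c) = ip a b - ip a c := by
  rw [ip_comm, ip_sub_left, ip_comm b, ip_comm c]

theorem ip_self_nonneg (a : Pt n m) : 0 ≤ ip a a :=
  add_nonneg (Finset.sum_nonneg fun _ _ => mul_self_nonneg _)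
    (Finset.sum_nonneg fun _ _ => mul_self_nonneg _)

theorem ip_eq_dotProduct (a b : Pt n m) : ip a b = dotProduct (vec a) (vec b) := by
  simp [ip, vec, dotProduct]

theorem ip_sq_le (a b : Pt n m) : ip a b ^ 2 ≤ ip a a * ip b b := by
  have := Finset.sum_mul_sq_le_sq_mul_sq Finset.univ (vec a) (vec b)
  simpa only [ip_eq_dotProduct, dotProduct, sq] using this

theorem norm_sq_le_ip (a : Pt n m) : ‖a‖ ^ 2 ≤ ip a a := by
  have key : ‖a‖ ≤ Real.sqrt (ip a a) := by
    refine max_le ((pi_norm_le_iff_of_nonneg (Real.sqrt_nonneg _)).2 fun i => ?_)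
      ((pi_norm_le_iff_of_nonneg (Real.sqrt_nonneg _)).2 fun j => ?_)
    · refine Real.abs_le_sqrt ?_
      have h1 := Finset.single_le_sum (f := fun i => a.1 i * a.1 i)
        (fun _ _ => mul_self_nonneg _) (Finset.mem_univ i)
      have h2 : 0 ≤ ∑ j, a.2 j * a.2 j := Finset.sum_nonneg fun _ _ => mul_self_nonneg _
      simp only [ip]
      linarith
    · refine Real.abs_le_sqrt ?_
      have h1 := Finset.single_le_sum (f := fun j => a.2 j * a.2 j)
        (fun _ _ => mul_self_nonneg _) (Finset.mem_univ j)
      have h2 : 0 ≤ ∑ i, a.1 i * a.1 i := Finset.sum_nonneg fun _ _ => mul_self_nonneg _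
      simp only [ip]
      linarith
  calc ‖a‖ ^ 2 ≤ Real.sqrt (ip a a) ^ 2 := by gcongr
    _ = ip a a := Real.sq_sqrt (ip_self_nonneg a)

theorem eDist_eq_sqrt (a b : Pt n m) : eDist a b = Real.sqrt (ip (a - b) (a - b)) := by
  simp [eDist, ip, sq]

theorem eDist_eq_iff (a b c : Pt n m) :
    eDist a c = eDist b c ↔ ip (a - c) (a - c) = ip (b - c) (b - c) := by
  rw [eDist_eq_sqrt, eDist_eq_sqrt, Real.sqrt_inj (ip_self_nonneg _) (ip_self_nonneg _)]

theorem HasDerivAt.ip {a b : ℝ → Pt n m} {a' b' : Pt n m} {t : ℝ} (ha : HasDerivAt a a' t)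
    (hb : HasDerivAt b b' t) :
    HasDerivAt (fun t => _root_.ip (a t) (b t))
      (_root_.ip a' (b t) + _root_.ip (a t) b') t := by
  have ha1 := hasDerivAt_pi.1 (hasFDerivAt_fst.comp_hasDerivAt t ha)
  have hb1 := hasDerivAt_pi.1 (hasFDerivAt_fst.comp_hasDerivAt t hb)
  have ha2 := hasDerivAt_pi.1 (hasFDerivAt_snd.comp_hasDerivAt t ha)
  have hb2 := hasDerivAt_pi.1 (hasFDerivAt_snd.comp_hasDerivAt t hb)
  have h := (HasDerivAt.fun_sum fun i (_ : i ∈ Finset.univ) => (ha1 i).mul (hb1 i)).add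
    (HasDerivAt.fun_sum fun j (_ : j ∈ Finset.univ) => (ha2 j).mul (hb2 j))
  refine h.congr_deriv ?_
  simp only [_root_.ip, Finset.sum_add_distrib, Function.comp_apply,
    ContinuousLinearMap.coe_fst', ContinuousLinearMap.coe_snd']
  ring

theorem hasDerivAt_ip_self {a : ℝ → Pt n m} {a' : Pt n m} {t : ℝ} (ha : HasDerivAt a a' t) :
    HasDerivAt (fun t => ip (a t) (a t)) (2 * ip (a t) a') t :=
  (ha.ip ha).congr_deriv (by rw [ip_comm a']; ring)

theorem ip_self_eq_of_orthogonal_deriv {w w' : ℝ → Pt n m} (hw : ∀ t, HasDerivAt w (w' t) t)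
    (h : ∀ t, ip (w t) (w' t) = 0) (s t : ℝ) : ip (w s) (w s) = ip (w t) (w t) :=
  is_const_of_deriv_eq_zero (fun t => (hasDerivAt_ip_self (hw t)).differentiableAt)
    (fun t => by rw [(hasDerivAt_ip_self (hw t)).deriv, h, mul_zero]) s t

/-- A trajectory of a linear isometric flow is recurrent, so every linear functional that is
monotone along it is constant along it. -/
theorem ip_eq_of_monotone_of_skew (L : Pt n m →L[ℝ] Pt n m) (hL : ∀ w, ip w (L w) = 0)
    {z : ℝ → Pt n m} (hz : ∀ t, HasDerivAt z (L (z t)) t) (c : Pt n m)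
    (hmono : Monotone fun t => ip (z t) c) (s t : ℝ) : ip (z s) c = ip (z t) c := by
  wlog hst : s < t generalizing s t
  · rcases (not_lt.1 hst).eq_or_lt with h | h
    · rw [h]
    · exact (this t s h).symm
  have hnorm : ∀ r, ip (z r) (z r) = ip (z 0) (z 0) := fun r =>
    ip_self_eq_of_orthogonal_deriv hz (fun t => hL _) r 0
  have hshift : ∀ p a b, ip (z (a + p) - z a) (z (a + p) - z a)
      = ip (z (b + p) - z b) (z (b + p) - z b) := fun p a b =>
    ip_self_eq_of_orthogonal_deriv (w := fun r => z (r + p) - z r)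
      (w' := fun r => L (z (r + p) - z r))
      (fun r => (((hz (r + p)).comp_add_const r p).sub (hz r)).congr_deriv (map_sub L _ _).symm)
      (fun r => hL _) a b
  obtain ⟨a, -, k, hk, hlim⟩ := tendsto_subseq_of_bounded
    (x := fun j : ℕ => z (j * (t - s))) (s := Metric.closedBall 0 (Real.sqrt (ip (z 0) (z 0))))
    Metric.isBounded_closedBall (fun j => by
      rw [mem_closedBall_zero_iff]
      exact Real.le_sqrt_of_sq_le ((norm_sq_le_ip _).trans (hnorm _).le))
  have hcont : Continuous fun w : Pt n m => ip w w := by unfold ip; fun_prop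
  have hdiff := (hlim.comp (Filter.tendsto_add_atTop_nat 1)).sub hlim
  rw [sub_self] at hdiff
  have hdiff' := ((hcont.tendsto _).comp hdiff).mul_const (ip c c)
  have hle : (ip (z t) c - ip (z s) c) ^ 2 ≤ ip (0 : Pt n m) 0 * ip c c := by
    refine ge_of_tendsto' hdiff' fun j => ?_
    set p : ℝ := ((k (j + 1) : ℝ) - k j) * (t - s) with hp
    have hkk : (k j : ℝ) + 1 ≤ k (j + 1) := by exact_mod_cast hk (Nat.lt_succ_self j)
    have hpt : t ≤ s + p := by nlinarith
    have h1 : ip (z s) c ≤ ip (z t) c := hmono hst.le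
    have h2 : ip (z t) c ≤ ip (z (s + p)) c := hmono hpt
    have h3 := ip_sq_le (z (s + p) - z s) c
    rw [hshift p s (k j * (t - s)), show (k j : ℝ) * (t - s) + p = k (j + 1) * (t - s) by
      rw [hp]; ring, ip_sub_left] at h3
    refine le_trans ?_ h3
    gcongr
  have h00 : ip (0 : Pt n m) 0 = 0 := by simp [ip]
  rw [h00, zero_mul] at hle
  have := pow_eq_zero_iff (two_ne_zero) |>.1 (le_antisymm hle (sq_nonneg _))
  linarith

end InnerProduct

section Hessian
variable {n m : ℕ} {φ : Pt n m → ℝ}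

theorem ContDiff.differentiable_fderiv_apply (hφ : ContDiff ℝ 2 φ) (u : Pt n m) :
    Differentiable ℝ fun w => fderiv ℝ φ w u :=
  ((hφ.fderiv_right (m := 1) (by norm_num)).clm_apply contDiff_const).differentiable (by simp)

theorem hess_eq (hφ : ContDiff ℝ 2 φ) (z u v : Pt n m) :
    hess φ z u v = fderiv ℝ (fderiv ℝ φ) z v u := by
  have hd := ((hφ.fderiv_right (m := 1) (by norm_num)).differentiable (by simp)) z
  rw [hess, fderiv_clm_apply hd (differentiableAt_const u)]
  simp

theorem hess_comm (hφ : ContDiff ℝ 2 φ) (z u v : Pt n m) : hess φ z u v = hess φ z v u := by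
  rw [hess_eq hφ, hess_eq hφ]
  exact (hφ.contDiffAt.isSymmSndFDerivAt (by simp)) v u

theorem sum_ex (x : Fin n → ℝ) : ∑ i, x i • (ex i : Pt n m) = (x, 0) := by
  ext k <;> simp [ex, Prod.fst_sum, Prod.snd_sum, Finset.sum_apply, Pi.single_apply]

theorem sum_ey (y : Fin m → ℝ) : ∑ j, y j • (ey j : Pt n m) = (0, y) := by
  ext k <;> simp [ey, Prod.fst_sum, Prod.snd_sum, Finset.sum_apply, Pi.single_apply]

theorem sum_hess_ex (z u : Pt n m) (x : Fin n → ℝ) :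
    ∑ i, hess φ z u (ex i) * x i = hess φ z u (x, 0) := by
  simp only [hess, ← sum_ex x, map_sum, map_smul, smul_eq_mul, mul_comm]

theorem sum_hess_ey (z u : Pt n m) (y : Fin m → ℝ) :
    ∑ j, hess φ z u (ey j) * y j = hess φ z u (0, y) := by
  simp only [hess, ← sum_ey y, map_sum, map_smul, smul_eq_mul, mul_comm]

theorem matA_mulVec (z w : Pt n m) : (matA φ z).mulVec (vec w) =
    Sum.elim (fun i => hess φ z (ex i) (0, w.2)) (fun j => -hess φ z (ey j) (w.1, 0)) := by
  ext (i | j)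
  · simp [matA, vec, Matrix.mulVec, dotProduct, sum_hess_ey]
  · simp [matA, vec, Matrix.mulVec, dotProduct, sum_hess_ex]

theorem matB_mulVec (z w : Pt n m) : (matB φ z).mulVec (vec w) =
    Sum.elim (fun i => hess φ z (ex i) (w.1, 0)) (fun j => -hess φ z (ey j) (0, w.2)) := by
  ext (i | j)
  · simp [matB, vec, Matrix.mulVec, dotProduct, sum_hess_ex]
  · simp [matB, vec, Matrix.mulVec, dotProduct, sum_hess_ey]

theorem ip_matA_mulVec (hφ : ContDiff ℝ 2 φ) (z w : Pt n m) :
    ip w (unvec ((matA φ z).mulVec (vec w))) = 0 := by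
  have h1 : ∑ i, w.1 i * hess φ z (ex i) (0, w.2) = hess φ z (w.1, 0) (0, w.2) := by
    rw [hess_comm hφ, ← sum_hess_ex]
    exact Finset.sum_congr rfl fun i _ => by rw [hess_comm hφ, mul_comm]
  have h2 : ∑ j, w.2 j * hess φ z (ey j) (w.1, 0) = hess φ z (w.1, 0) (0, w.2) := by
    rw [← sum_hess_ey]
    exact Finset.sum_congr rfl fun j _ => by rw [hess_comm hφ, mul_comm]
  simp [ip, unvec, matA_mulVec, h1, h2]

theorem ip_grad (z w : Pt n m) :
    ip w (gradX φ z, -gradY φ z) = fderiv ℝ φ z (w.1, -w.2) := by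
  have h : ((w.1, -w.2) : Pt n m) = (w.1, 0) - (0, w.2) := by simp
  rw [h, map_sub, ← sum_ex, ← sum_ey, map_sum, map_sum]
  simp only [map_smul, smul_eq_mul, ip, gradX, gradY, Pi.neg_apply, mul_neg,
    Finset.sum_neg_distrib, sub_eq_add_neg]
  rfl

theorem hasDerivAt_fderiv_apply (hφ : ContDiff ℝ 2 φ) (u v : Pt n m) {c : ℝ → Pt n m} {t : ℝ}
    (hc : HasDerivAt c v t) :
    HasDerivAt (fun t => fderiv ℝ φ (c t) u) (hess φ (c t) u v) t :=
  (hφ.differentiable_fderiv_apply u (c t)).hasFDerivAt.comp_hasDerivAt t hc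

theorem IsSaddle.grad_eq_zero (hφ : Differentiable ℝ φ) {z : Pt n m} (h : IsSaddle φ z) :
    gradX φ z = 0 ∧ gradY φ z = 0 := by
  have d1 := (hφ (z.1, z.2)).hasFDerivAt.comp z.1 (hasFDerivAt_prodMk_left (𝕜 := ℝ) z.1 z.2)
  have d2 := (hφ (z.1, z.2)).hasFDerivAt.comp z.2 (hasFDerivAt_prodMk_right (𝕜 := ℝ) z.1 z.2)
  have m1 : IsLocalMax (φ ∘ fun x => (x, z.2)) z.1 :=
    Filter.Eventually.of_forall fun x => (h x z.2).1
  have m2 : IsLocalMin (φ ∘ fun y => (z.1, y)) z.2 :=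
    Filter.Eventually.of_forall fun y => (h z.1 y).2
  exact ⟨funext fun i => by
    simpa [gradX] using DFunLike.congr_fun (m1.hasFDerivAt_eq_zero d1) _,
    funext fun j => by
    simpa [gradY] using DFunLike.congr_fun (m2.hasFDerivAt_eq_zero d2) _⟩

end Hessian

section SaddleDynamics
variable {n m : ℕ} {φ : Pt n m → ℝ}

/-- The condition `w ∈ ker B(r w) ∩ ker (A(r w) - A(0))` for all `r ∈ [0, 1]`. -/
def InKernels (φ : Pt n m → ℝ) (w : Pt n m) : Prop :=
  ∀ r ∈ Set.Icc (0 : ℝ) 1, (matB φ (r • w)).mulVec (vec w) = 0 ∧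
    (matA φ (r • w) - matA φ 0).mulVec (vec w) = 0

theorem inKernels_iff (w : Pt n m) : InKernels φ w ↔ ∀ r ∈ Set.Icc (0 : ℝ) 1,
    ((∀ i, hess φ (r • w) (ex i) (w.1, 0) = 0) ∧ ∀ j, hess φ (r • w) (ey j) (0, w.2) = 0) ∧
    (∀ i, hess φ (r • w) (ex i) (0, w.2) = hess φ 0 (ex i) (0, w.2)) ∧
      ∀ j, hess φ (r • w) (ey j) (w.1, 0) = hess φ 0 (ey j) (w.1, 0) := by
  simp only [InKernels, Matrix.sub_mulVec, sub_eq_zero, matA_mulVec, matB_mulVec,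
    funext_iff, Sum.forall, Sum.elim_inl, Sum.elim_inr, Pi.zero_apply, neg_eq_zero, neg_inj]

theorem InKernels.grad_eq (hφ : ContDiff ℝ 2 φ) (h0 : IsSaddle φ (0 : Pt n m)) {w : Pt n m}
    (hw : InKernels φ w) :
    (gradX φ w, -gradY φ w) = unvec ((matA φ 0).mulVec (vec w)) := by
  rw [inKernels_iff] at hw
  have h00 := h0.grad_eq_zero (hφ.differentiable (by simp))
  have key : ∀ u c, fderiv ℝ φ 0 u = 0 →
      (∀ r ∈ Set.Icc (0 : ℝ) 1, hess φ (r • w) u (w.1, 0) + hess φ (r • w) u (0, w.2) = c) →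
      fderiv ℝ φ w u = c := by
    intro u c hu hc
    have hd : ∀ r : ℝ, HasDerivAt (fun r : ℝ => fderiv ℝ φ (r • w) u) (hess φ (r • w) u w) r :=
      fun r => hasDerivAt_fderiv_apply hφ u w (by simpa using (hasDerivAt_id r).smul_const w)
    obtain ⟨r, hr, hslope⟩ := exists_hasDerivAt_eq_slope (fun r : ℝ => fderiv ℝ φ (r • w) u) _
      one_pos (fun r _ => (hd r).continuousAt.continuousWithinAt) (fun r _ => hd r)
    have hsplit : hess φ (r • w) u w = hess φ (r • w) u (w.1, 0) + hess φ (r • w) u (0, w.2) := by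
      rw [hess, hess, hess, ← map_add]
      simp
    rw [hsplit, hc r (Set.Ioo_subset_Icc_self hr)] at hslope
    simpa [hu] using hslope.symm
  simp only [unvec, matA_mulVec, Sum.elim_inl, Sum.elim_inr]
  refine Prod.ext (funext fun i => key (ex i) _ (congr_fun h00.1 i) fun r hr => ?_)
    (funext fun j => congr_arg Neg.neg (key (ey j) _ (congr_fun h00.2 j) fun r hr => ?_))
  · rw [(hw r hr).1.1 i, (hw r hr).2.1 i, zero_add]
  · rw [(hw r hr).1.2 j, (hw r hr).2.2 j, add_zero]

theorem inKernels_of_ip_grad_eq_zero (hφ : ContDiff ℝ 2 φ) (hcc : ConcaveConvex φ)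
    (h0 : IsSaddle φ (0 : Pt n m)) {w : Pt n m} (hw : ip w (gradX φ w, -gradY φ w) = 0) :
    InKernels φ w := by
  have hdiff := hφ.differentiable (by simp)
  have hw' : 0 ≤ fderiv ℝ φ (w.1, w.2) (w.1, -w.2) := by rw [← hw, ip_grad]
  have derivs : ∀ r s : ℝ, HasDerivAt (fun r : ℝ => ((r • w.1, s • w.2) : Pt n m)) (w.1, 0) r ∧
      HasDerivAt (fun s : ℝ => ((r • w.1, s • w.2) : Pt n m)) (0, w.2) s := fun r s =>
    ⟨HasDerivAt.prodMk (by simpa using (hasDerivAt_id r).smul_const w.1) (hasDerivAt_const r _),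
      HasDerivAt.prodMk (hasDerivAt_const s _) (by simpa using (hasDerivAt_id s).smul_const w.2)⟩
  have uniq : ∀ {g g' : ℝ → ℝ} {a b r : ℝ}, HasDerivAt g a r → HasDerivAt g' b r →
      r ∈ Set.Icc (0 : ℝ) 1 → (∀ r ∈ Set.Icc (0 : ℝ) 1, g r = g' r) → a = b := by
    intro g g' a b r hg hg' hr h
    exact (uniqueDiffOn_Icc_zero_one r hr).eq_deriv _ hg.hasDerivWithinAt
      (hg'.hasDerivWithinAt.congr h (h r hr))
  have hX : ∀ i, ∀ r ∈ Set.Icc (0 : ℝ) 1, ∀ s ∈ Set.Icc (0 : ℝ) 1,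
      fderiv ℝ φ (r • w.1, s • w.2) (ex i) = s * fderiv ℝ φ (w.1, w.2) (ex i) :=
    fun i r hr s hs => fderiv_fst_eq_of_saddle hdiff hcc.1 hcc.2 h0 hw' hr hs _
  have hY : ∀ j, ∀ r ∈ Set.Icc (0 : ℝ) 1, ∀ s ∈ Set.Icc (0 : ℝ) 1,
      fderiv ℝ φ (r • w.1, s • w.2) (ey j) = r * fderiv ℝ φ (w.1, w.2) (ey j) :=
    fun j r hr s hs => fderiv_snd_eq_of_saddle hdiff hcc.1 hcc.2 h0 hw' hr hs _
  have linear : ∀ c r : ℝ, HasDerivAt (fun r => r * c) c r := fun c r => by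
    simpa using (hasDerivAt_id r).mul_const c
  have hXX : ∀ i, ∀ r ∈ Set.Icc (0 : ℝ) 1, hess φ (r • w) (ex i) (w.1, 0) = 0 :=
    fun i r hr => uniq (hasDerivAt_fderiv_apply hφ (ex i) _ (derivs r r).1)
      (hasDerivAt_const r _) hr fun q hq => hX i q hq r hr
  have hXY : ∀ i, ∀ r ∈ Set.Icc (0 : ℝ) 1,
      hess φ (r • w) (ex i) (0, w.2) = fderiv ℝ φ (w.1, w.2) (ex i) :=
    fun i r hr => uniq (hasDerivAt_fderiv_apply hφ (ex i) _ (derivs r r).2)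
      (linear _ r) hr fun q hq => hX i r hr q hq
  have hYY : ∀ j, ∀ r ∈ Set.Icc (0 : ℝ) 1, hess φ (r • w) (ey j) (0, w.2) = 0 :=
    fun j r hr => uniq (hasDerivAt_fderiv_apply hφ (ey j) _ (derivs r r).2)
      (hasDerivAt_const r _) hr fun q hq => hY j r hr q hq
  have hYX : ∀ j, ∀ r ∈ Set.Icc (0 : ℝ) 1,
      hess φ (r • w) (ey j) (w.1, 0) = fderiv ℝ φ (w.1, w.2) (ey j) :=
    fun j r hr => uniq (hasDerivAt_fderiv_apply hφ (ey j) _ (derivs r r).1)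
      (linear _ r) hr fun q hq => hY j q hq r hr
  have zero_mem : (0 : ℝ) ∈ Set.Icc (0 : ℝ) 1 := ⟨le_rfl, zero_le_one⟩
  refine (inKernels_iff w).2 fun r hr => ⟨⟨fun i => hXX i r hr, fun j => hYY j r hr⟩,
    fun i => ?_, fun j => ?_⟩
  · rw [hXY i r hr, ← hXY i 0 zero_mem, zero_smul]
  · rw [hYX j r hr, ← hYX j 0 zero_mem, zero_smul]

theorem InS.inKernels (hφ : ContDiff ℝ 2 φ) (hcc : ConcaveConvex φ)
    (h0 : IsSaddle φ (0 : Pt n m)) {z : ℝ → Pt n m} (hz : InS φ z) (t : ℝ) :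
    InKernels φ (z t) := by
  refine inKernels_of_ip_grad_eq_zero hφ hcc h0 ?_
  have hconst : (fun t => ip (z t) (z t)) = fun _ => ip (z 0) (z 0) := funext fun t => by
    simpa using (eDist_eq_iff _ _ _).1 (hz.2 0 h0 t)
  have h := (hasDerivAt_ip_self (hz.1 t)).unique (hconst ▸ hasDerivAt_const t _)
  linarith

theorem inS_of_inKernels (hφ : ContDiff ℝ 2 φ) (hcc : ConcaveConvex φ)
    (h0 : IsSaddle φ (0 : Pt n m)) {z : ℝ → Pt n m}
    (hz : ∀ t, HasDerivAt z (unvec ((matA φ 0).mulVec (vec (z t)))) t)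
    (hk : ∀ t, InKernels φ (z t)) : InS φ z := by
  have hsol : IsSolution φ z := fun t => (hk t).grad_eq hφ h0 ▸ hz t
  refine ⟨hsol, fun zb hzb t => (eDist_eq_iff _ _ _).2 ?_⟩
  let L : Pt n m →ₗ[ℝ] Pt n m :=
    { toFun := fun w => unvec ((matA φ 0).mulVec (vec w))
      map_add' := fun v w => by
        have : vec (v + w) = vec v + vec w := by ext (i | j) <;> simp [vec]
        rw [this, Matrix.mulVec_add]
        rfl
      map_smul' := fun c w => by
        have : vec (c • w) = c • vec w := by ext (i | j) <;> simp [vec]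
        rw [this, Matrix.mulVec_smul]
        rfl }
  have hskew : ∀ w, ip w (L.toContinuousLinearMap w) = 0 := ip_matA_mulVec hφ 0
  have hnorm : ∀ t, ip (z t) (z t) = ip (z 0) (z 0) := fun t =>
    ip_self_eq_of_orthogonal_deriv hz (fun t => ip_matA_mulVec hφ 0 _) t 0
  have hexp : ∀ t, ip (z t - zb) (z t - zb) = ip (z 0) (z 0) - 2 * ip (z t) zb + ip zb zb := by
    intro t
    rw [ip_sub_left, ip_sub_right, ip_sub_right, hnorm, ip_comm zb (z t)]
    ring
  have hd : ∀ t, HasDerivAt (fun t => ip (z t - zb) (z t - zb)) _ t := fun t =>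
    hasDerivAt_ip_self ((hsol t).sub_const zb)
  have hanti : Antitone fun t => ip (z t - zb) (z t - zb) :=
    antitone_of_deriv_nonpos (fun t => (hd t).differentiableAt) fun t => by
      rw [(hd t).deriv, ip_grad]
      have := fderiv_nonpos_of_saddle (hφ.differentiable (by simp)) hcc.1 hcc.2 hzb
        (z t).1 (z t).2
      simp only [Prod.fst_sub, Prod.snd_sub]
      linarith
  have hmono : Monotone fun t => ip (z t) zb := fun s t hst => by
    have := hanti hst
    simp only [hexp] at this ⊢
    linarith
  rw [hexp, hexp, ip_eq_of_monotone_of_skew L.toContinuousLinearMap hskew hz zb hmono t 0]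

end SaddleDynamics

/-- Theorem 1 of the paper. Assume `0` is a saddle point of the `C²`
concave-convex `φ`. Every trajectory in `𝒮` solves the linear ODE `ż = A(0) z`; moreover, a
solution of `ż = A(0) z` is in `𝒮` iff for all `t ∈ ℝ` and `r ∈ [0,1]`,
`z(t) ∈ ker B(r z(t)) ∩ ker (A(r z(t)) - A(0))`. -/
theorem limiting_solutions_linear_ODE {n m : ℕ} (φ : Pt n m → ℝ)
    (hφ : ContDiff ℝ 2 φ) (hcc : ConcaveConvex φ)
    (h0 : IsSaddle φ (0 : Pt n m)) :
    (∀ z : ℝ → Pt n m, InS φ z →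
      ∀ t, HasDerivAt z (unvec ((matA φ 0).mulVec (vec (z t)))) t) ∧
    (∀ z : ℝ → Pt n m,
      (∀ t, HasDerivAt z (unvec ((matA φ 0).mulVec (vec (z t)))) t) →
      (InS φ z ↔ ∀ t : ℝ, ∀ r ∈ Set.Icc (0 : ℝ) 1,
        (matB φ (r • z t)).mulVec (vec (z t)) = 0 ∧
        (matA φ (r • z t) - matA φ 0).mulVec (vec (z t)) = 0)) := by
  have hin := fun z (hz : InS φ z) => hz.inKernels hφ hcc h0
  exact ⟨fun z hz t => (hin z hz t).grad_eq hφ h0 ▸ hz.1 t,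
    fun z hz => ⟨hin z, inS_of_inKernels hφ hcc h0 hz⟩⟩
end

section
/- Let φ : ℝⁿ × ℝᵐ → ℝ be C² and concave-convex, and suppose φ has a saddle point z̄ that is locally asymptotically stable as an equilibrium of the gradient dynamics. Then z̄ is the unique saddle point of φ, and every trajectory in S is the constant trajectory at z̄. -/
open scoped BigOperators

section PartialGradients

variable {E F : Type*} [NormedAddCommGroup E] [NormedSpace ℝ E]
  [NormedAddCommGroup F] [NormedSpace ℝ F]

/-- A differentiable convex function lies above its tangent planes. -/
theorem ConvexOn.add_fderiv_le_s10 {g : E → ℝ} (hg : ConvexOn ℝ Set.univ g) {g' : E →L[ℝ] ℝ}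
    {x : E} (hx : HasFDerivAt g g' x) (v : E) : g x + g' (v - x) ≤ g v := by
  have hline : HasDerivAt (fun t : ℝ => x + t • (v - x)) (v - x) 0 := by
    simpa using ((hasDerivAt_id (0 : ℝ)).smul_const (v - x)).const_add x
  have hd : HasDerivAt (fun t : ℝ => g (x + t • (v - x))) (g' (v - x)) 0 := by
    refine HasFDerivAt.comp_hasDerivAt (0 : ℝ) ?_ hline
    simpa using hx
  have hc : ConvexOn ℝ Set.univ (fun t : ℝ => g (x + t • (v - x))) := by
    refine ⟨convex_univ, fun s _ t _ a b ha hb hab => ?_⟩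
    have h := hg.2 (Set.mem_univ (x + s • (v - x))) (Set.mem_univ (x + t • (v - x))) ha hb hab
    convert h using 2
    obtain rfl : b = 1 - a := by linarith
    simp only [smul_eq_mul]
    module
  have h := hc.le_slope_of_hasDerivAt (Set.mem_univ 0) (Set.mem_univ 1) one_pos hd
  simp only [slope_def_field, one_smul, zero_smul, add_zero, sub_zero, div_one,
    add_sub_cancel] at h
  linarith

theorem hasFDerivAt_partial_fst {f : E × F → ℝ} (hf : Differentiable ℝ f) (x : E) (y : F) :
    HasFDerivAt (fun v => f (v, y)) ((fderiv ℝ f (x, y)).comp (.inl ℝ E F)) x :=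
  (hf (x, y)).hasFDerivAt.comp x (hasFDerivAt_prodMk_left x y)

theorem hasFDerivAt_partial_snd {f : E × F → ℝ} (hf : Differentiable ℝ f) (x : E) (y : F) :
    HasFDerivAt (fun w => f (x, w)) ((fderiv ℝ f (x, y)).comp (.inr ℝ E F)) y :=
  (hf (x, y)).hasFDerivAt.comp y (hasFDerivAt_prodMk_right x y)

theorem le_add_fderiv_fst {f : E × F → ℝ} (hf : Differentiable ℝ f)
    (hc : ∀ y, ConcaveOn ℝ Set.univ fun x => f (x, y)) (x v : E) (y : F) :
    f (v, y) ≤ f (x, y) + fderiv ℝ f (x, y) (v - x, 0) := by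
  have h := (hc y).neg.add_fderiv_le_s10 (hasFDerivAt_partial_fst hf x y).neg v
  simp at h
  linarith

theorem add_fderiv_snd_le {f : E × F → ℝ} (hf : Differentiable ℝ f)
    (hc : ∀ x, ConvexOn ℝ Set.univ fun y => f (x, y)) (x : E) (y w : F) :
    f (x, y) + fderiv ℝ f (x, y) (0, w - y) ≤ f (x, w) := by
  simpa using (hc x).add_fderiv_le_s10 (hasFDerivAt_partial_snd hf x y) w

theorem fderiv_neg_snd_eq (f : E × F → ℝ) (z : E × F) (u : E) (v : F) :
    fderiv ℝ f z (u, -v) = fderiv ℝ f z (u, 0) - fderiv ℝ f z (0, v) := by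
  rw [← map_sub]
  simp

/-- The gradient field of a concave-convex function is dissipative. -/
theorem fderiv_saddle_dissipative {f : E × F → ℝ} (hf : Differentiable ℝ f)
    (hc : ∀ y, ConcaveOn ℝ Set.univ fun x => f (x, y))
    (hv : ∀ x, ConvexOn ℝ Set.univ fun y => f (x, y)) (x x' : E) (y y' : F) :
    fderiv ℝ f (x, y) (x - x', -(y - y')) ≤ fderiv ℝ f (x', y') (x - x', -(y - y')) := by
  have h1 := le_add_fderiv_fst hf hc x x' y
  have h2 := le_add_fderiv_fst hf hc x' x y'
  have h3 := add_fderiv_snd_le hf hv x y y'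
  have h4 := add_fderiv_snd_le hf hv x' y' y
  have e1 : fderiv ℝ f (x, y) (x' - x, 0) = - fderiv ℝ f (x, y) (x - x', 0) := by
    rw [← map_neg]; simp
  have e2 : fderiv ℝ f (x, y) (0, y' - y) = - fderiv ℝ f (x, y) (0, y - y') := by
    rw [← map_neg]; simp
  rw [fderiv_neg_snd_eq, fderiv_neg_snd_eq]
  linarith

/-- If the gradient field at `(x, y)` is orthogonal to the displacement from a saddle point
`(p, q)`, then `f (p, y) = f (p, q)` and the `x`-gradient agrees at `(p, y)` and `(x, y)`. -/
theorem eq_saddle_of_fderiv_eq_zero {f : E × F → ℝ} (hf : Differentiable ℝ f)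
    (hc : ∀ y, ConcaveOn ℝ Set.univ fun x => f (x, y))
    (hv : ∀ x, ConvexOn ℝ Set.univ fun y => f (x, y)) {p : E} {q : F}
    (hs : ∀ x y, f (x, q) ≤ f (p, q) ∧ f (p, q) ≤ f (p, y)) {x : E} {y : F}
    (h : fderiv ℝ f (x, y) (x - p, -(y - q)) = 0) :
    f (p, y) = f (p, q) ∧ f (x, q) = f (p, q) ∧
      ∀ u, fderiv ℝ f (p, y) (u, 0) = fderiv ℝ f (x, y) (u, 0) := by
  have h1 := le_add_fderiv_fst hf hc x p y
  have h2 := add_fderiv_snd_le hf hv x y q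
  have e1 : fderiv ℝ f (x, y) (p - x, 0) = - fderiv ℝ f (x, y) (x - p, 0) := by
    rw [← map_neg]; simp
  have e2 : fderiv ℝ f (x, y) (0, q - y) = - fderiv ℝ f (x, y) (0, y - q) := by
    rw [← map_neg]; simp
  rw [fderiv_neg_snd_eq] at h
  obtain ⟨h3, h4⟩ := hs x y
  refine ⟨by linarith, by linarith, fun u => ?_⟩
  set L : E →L[ℝ] ℝ := (fderiv ℝ f (x, y)).comp (.inl ℝ E F) with hL
  have hLa : ∀ v, L v = fderiv ℝ f (x, y) (v, 0) := fun v => by simp [hL]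
  have hmax : IsLocalMax (fun v => f (v, y) - L v) p := by
    refine Filter.Eventually.of_forall fun v => ?_
    have h5 := le_add_fderiv_fst hf hc x v y
    rw [← hLa, map_sub] at h1 h5 h
    linarith
  have hz := hmax.hasFDerivAt_eq_zero ((hasFDerivAt_partial_fst hf p y).sub L.hasFDerivAt)
  have := congrArg (fun T : E →L[ℝ] ℝ => T u) hz
  simp [hL] at this
  linarith

theorem fderiv_fst_eq_zero_of_isMax {f : E × F → ℝ} (hf : Differentiable ℝ f) {x : E} {y : F}
    (h : ∀ v, f (v, y) ≤ f (x, y)) (u : E) : fderiv ℝ f (x, y) (u, 0) = 0 := by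
  have hmax : IsLocalMax (fun v => f (v, y)) x := Filter.Eventually.of_forall h
  have hz := hmax.hasFDerivAt_eq_zero (hasFDerivAt_partial_fst hf x y)
  simpa using congrArg (fun T : E →L[ℝ] ℝ => T u) hz

theorem fderiv_snd_eq_zero_of_isMin {f : E × F → ℝ} (hf : Differentiable ℝ f) {x : E} {y : F}
    (h : ∀ w, f (x, y) ≤ f (x, w)) (v : F) : fderiv ℝ f (x, y) (0, v) = 0 := by
  have hmin : IsLocalMin (fun w => f (x, w)) y := Filter.Eventually.of_forall h
  have hz := hmin.hasFDerivAt_eq_zero (hasFDerivAt_partial_snd hf x y)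
  simpa using congrArg (fun T : F →L[ℝ] ℝ => T v) hz

/-- Orthogonality of the gradient field to the displacement from a saddle point propagates
along the segment towards the saddle point. -/
theorem fderiv_segment_eq_zero {f : E × F → ℝ} (hf : Differentiable ℝ f)
    (hc : ∀ y, ConcaveOn ℝ Set.univ fun x => f (x, y))
    (hv : ∀ x, ConvexOn ℝ Set.univ fun y => f (x, y)) {p : E} {q : F}
    (hs : ∀ x y, f (x, q) ≤ f (p, q) ∧ f (p, q) ≤ f (p, y)) {x : E} {y : F}
    (h : fderiv ℝ f (x, y) (x - p, -(y - q)) = 0) {s : ℝ} (hs0 : 0 < s) (hs1 : s ≤ 1) :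
    fderiv ℝ f (p + s • (x - p), q + s • (y - q)) (x - p, -(y - q)) = 0 := by
  obtain rfl | hs1 := hs1.eq_or_lt
  · simpa using h
  have h0 : fderiv ℝ f (p, q) (x - p, -(y - q)) = 0 := by
    rw [fderiv_neg_snd_eq, fderiv_fst_eq_zero_of_isMax hf (fun v => (hs v q).1),
      fderiv_snd_eq_zero_of_isMin hf (fun w => (hs p w).2), sub_zero]
  have h1 := fderiv_saddle_dissipative hf hc hv (p + s • (x - p)) p (q + s • (y - q)) q
  have h2 := fderiv_saddle_dissipative hf hc hv x (p + s • (x - p)) y (q + s • (y - q))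
  have e1 : (p + s • (x - p) - p, -(q + s • (y - q) - q)) = s • (x - p, -(y - q)) := by
    simp only [Prod.smul_mk, add_sub_cancel_left, smul_neg]
  have e2 : (x - (p + s • (x - p)), -(y - (q + s • (y - q)))) =
      (1 - s) • (x - p, -(y - q)) := by
    simp only [Prod.smul_mk, Prod.mk.injEq]
    constructor <;> module
  rw [e1, map_smul, map_smul, h0, smul_zero, smul_eq_mul] at h1
  rw [e2, map_smul, map_smul, h, smul_zero, smul_eq_mul] at h2
  exact le_antisymm (nonpos_of_mul_nonpos_right h1 hs0)
    (nonneg_of_mul_nonneg_right h2 (sub_pos.2 hs1))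

/-- Where the gradient field is orthogonal to the displacement from a saddle point, the
`x`-gradient is homogeneous of degree one along the segment towards the saddle point. -/
theorem fderiv_fst_segment {f : E × F → ℝ} (hf : Differentiable ℝ f)
    (hc : ∀ y, ConcaveOn ℝ Set.univ fun x => f (x, y))
    (hv : ∀ x, ConvexOn ℝ Set.univ fun y => f (x, y)) {p : E} {q : F}
    (hs : ∀ x y, f (x, q) ≤ f (p, q) ∧ f (p, q) ≤ f (p, y)) {x : E} {y : F}
    (h : fderiv ℝ f (x, y) (x - p, -(y - q)) = 0) {s : ℝ} (hs0 : 0 < s) (hs1 : s ≤ 1) (u : E) :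
    fderiv ℝ f (p + s • (x - p), q + s • (y - q)) (u, 0) = s * fderiv ℝ f (x, y) (u, 0) := by
  obtain ⟨hy, -, hgrad⟩ := eq_saddle_of_fderiv_eq_zero hf hc hv hs h
  have hseg := fderiv_segment_eq_zero hf hc hv hs h hs0 hs1
  obtain ⟨hys, -, hgrads⟩ := eq_saddle_of_fderiv_eq_zero (x := p + s • (x - p))
    (y := q + s • (y - q)) hf hc hv hs (by
      have e1 : (p + s • (x - p) - p, -(q + s • (y - q) - q)) = s • (x - p, -(y - q)) := by
        simp only [Prod.smul_mk, add_sub_cancel_left, smul_neg]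
      rw [e1, map_smul, hseg, smul_zero])
  rw [← hgrad, ← hgrads]
  have hline : ∀ w, HasDerivAt (fun t : ℝ => f (p + t • u, w)) (fderiv ℝ f (p, w) (u, 0)) 0 := by
    intro w
    have hl : HasDerivAt (fun t : ℝ => p + t • u) u 0 := by
      simpa using ((hasDerivAt_id (0 : ℝ)).smul_const u).const_add p
    have := HasFDerivAt.comp_hasDerivAt (0 : ℝ) (f := fun t : ℝ => p + t • u)
      (l := fun v => f (v, w)) (by simpa using hasFDerivAt_partial_fst hf p w) hl
    simpa [Function.comp_def] using this
  have hmin : IsLocalMin (fun t : ℝ => (1 - s) * f (p + t • u, q) + s * f (p + t • u, y)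
      - f (p + t • u, q + s • (y - q))) 0 := by
    refine Filter.Eventually.of_forall fun t => ?_
    have h1 := (hv (p + t • u)).2 (Set.mem_univ q) (Set.mem_univ y) (sub_nonneg.2 hs1) hs0.le
      (sub_add_cancel 1 s)
    have e : (1 - s) • q + s • y = q + s • (y - q) := by module
    simp only [e, smul_eq_mul] at h1
    simp only [zero_smul, add_zero, hy, hys]
    linarith
  have hz := hmin.hasDerivAt_eq_zero
    ((((hline q).const_mul (1 - s)).add ((hline y).const_mul s)).sub (hline (q + s • (y - q))))
  rw [fderiv_fst_eq_zero_of_isMax hf (fun v => (hs v q).1)] at hz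
  linarith

theorem fderiv_neg_swap {f : E × F → ℝ} (hf : Differentiable ℝ f) (x : E) (y : F) (v : F)
    (u : E) :
    fderiv ℝ (fun z : F × E => -f (z.2, z.1)) (y, x) (v, u) = -fderiv ℝ f (x, y) (u, v) := by
  have h : HasFDerivAt (fun z : F × E => -f (z.2, z.1))
      (-((fderiv ℝ f (x, y)).comp
        ((ContinuousLinearMap.snd ℝ F E).prod (ContinuousLinearMap.fst ℝ F E)))) (y, x) :=
    ((hf (x, y)).hasFDerivAt.comp (y, x)
      (hasFDerivAt_snd.prodMk hasFDerivAt_fst)).neg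
  rw [h.fderiv]
  simp

/-- Where the gradient field is orthogonal to the displacement from a saddle point, the
`y`-gradient is homogeneous of degree one along the segment towards the saddle point. -/
theorem fderiv_snd_segment {f : E × F → ℝ} (hf : Differentiable ℝ f)
    (hc : ∀ y, ConcaveOn ℝ Set.univ fun x => f (x, y))
    (hv : ∀ x, ConvexOn ℝ Set.univ fun y => f (x, y)) {p : E} {q : F}
    (hs : ∀ x y, f (x, q) ≤ f (p, q) ∧ f (p, q) ≤ f (p, y)) {x : E} {y : F}
    (h : fderiv ℝ f (x, y) (x - p, -(y - q)) = 0) {s : ℝ} (hs0 : 0 < s) (hs1 : s ≤ 1) (v : F) :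
    fderiv ℝ f (p + s • (x - p), q + s • (y - q)) (0, v) = s * fderiv ℝ f (x, y) (0, v) := by
  have hg : Differentiable ℝ fun z : F × E => -f (z.2, z.1) := by fun_prop
  have key := fderiv_fst_segment (f := fun z : F × E => -f (z.2, z.1)) (p := q) (q := p)
    (x := y) (y := x) hg (fun x => (hv x).neg) (fun y => (hc y).neg)
    (fun y x => ⟨neg_le_neg (hs x y).2, neg_le_neg (hs x y).1⟩)
    (by
      rw [fderiv_neg_swap hf, ← map_neg]
      simpa using h) hs0 hs1 v
  rw [fderiv_neg_swap hf, fderiv_neg_swap hf] at key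
  linarith

end PartialGradients

theorem fderiv_apply_eq_sum_grad {n m : ℕ} (φ : Pt n m → ℝ) (z : Pt n m) (u : Fin n → ℝ)
    (v : Fin m → ℝ) :
    fderiv ℝ φ z (u, v) = ∑ i, u i * gradX φ z i + ∑ j, v j * gradY φ z j := by
  have e : ((u, v) : Pt n m) = ∑ i, u i • ((Pi.single i 1, 0) : Pt n m) +
      ∑ j, v j • ((0, Pi.single j 1) : Pt n m) := by
    ext k
    · simp [Prod.fst_sum, Finset.sum_apply, Pi.single_apply]
    · simp [Prod.snd_sum, Finset.sum_apply, Pi.single_apply]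
  rw [e, map_add, map_sum, map_sum]
  simp only [map_smul, smul_eq_mul, gradX, gradY]

theorem eq_of_eDist_eq_zero {n m : ℕ} {a b : Pt n m} (h : eDist a b = 0) : a = b := by
  have h2 := eDist_sq a b
  rw [h, zero_pow two_ne_zero] at h2
  have h3 : 0 ≤ ∑ i, (a.1 i - b.1 i) ^ 2 := by positivity
  have h4 : 0 ≤ ∑ j, (a.2 j - b.2 j) ^ 2 := by positivity
  have h5 := (Finset.sum_eq_zero_iff_of_nonneg (fun i _ => sq_nonneg (a.1 i - b.1 i))).1
    (by linarith : ∑ i, (a.1 i - b.1 i) ^ 2 = 0)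
  have h6 := (Finset.sum_eq_zero_iff_of_nonneg (fun j _ => sq_nonneg (a.2 j - b.2 j))).1
    (by linarith : ∑ j, (a.2 j - b.2 j) ^ 2 = 0)
  ext k
  · exact sub_eq_zero.1 (pow_eq_zero_iff two_ne_zero |>.1 (h5 k (Finset.mem_univ k)))
  · exact sub_eq_zero.1 (pow_eq_zero_iff two_ne_zero |>.1 (h6 k (Finset.mem_univ k)))

theorem eDist_add_smul_sub {n m : ℕ} (a b : Pt n m) {s : ℝ} (hs : 0 ≤ s) :
    eDist (b + s • (a - b)) b = s * eDist a b := by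
  rw [eDist, eDist, ← Real.sqrt_sq hs, ← Real.sqrt_mul (sq_nonneg _), Real.sqrt_sq hs, mul_add,
    Finset.mul_sum, Finset.mul_sum]
  simp [mul_pow]

/-- A solution at constant distance from `zb` has its velocity orthogonal to the displacement
from `zb`. -/
theorem IsSolution.fderiv_eq_zero_of_eDist_const {n m : ℕ} {φ : Pt n m → ℝ} {z : ℝ → Pt n m}
    (hz : IsSolution φ z) {zb : Pt n m} (hd : ∀ t, eDist (z t) zb = eDist (z 0) zb) (t : ℝ) :
    fderiv ℝ φ (z t) ((z t).1 - zb.1, -((z t).2 - zb.2)) = 0 := by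
  have h1 : ∀ i, HasDerivAt (fun s => (z s).1 i) (gradX φ (z t) i) t := fun i =>
    hasDerivAt_pi.1 (hz t).fst i
  have h2 : ∀ j, HasDerivAt (fun s => (z s).2 j) (-gradY φ (z t) j) t := fun j =>
    hasDerivAt_pi.1 (hz t).snd j
  have h3 := (HasDerivAt.fun_sum (u := Finset.univ) fun i _ =>
    ((h1 i).sub_const (zb.1 i)).fun_pow 2).fun_add
    (HasDerivAt.fun_sum (u := Finset.univ) fun j _ => ((h2 j).sub_const (zb.2 j)).fun_pow 2)
  have h4 : (fun s => ∑ i, ((z s).1 i - zb.1 i) ^ 2 + ∑ j, ((z s).2 j - zb.2 j) ^ 2) =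
      fun _ => eDist (z 0) zb ^ 2 := by
    funext s
    rw [← eDist_sq, hd]
  rw [h4] at h3
  have h5 := h3.unique (hasDerivAt_const t _)
  rw [fderiv_apply_eq_sum_grad]
  have h6 : ∀ a b c : ℝ, a + b = 0 → 2 * c = a + b → c = 0 := fun a b c _ _ => by linarith
  refine h6 _ _ _ h5 ?_
  rw [mul_add, Finset.mul_sum, Finset.mul_sum]
  congr 1 <;> refine Finset.sum_congr rfl fun k _ => ?_
  · simp
    ring
  · simp
    ring

/-- Contracting a solution at constant distance from a saddle point towards that saddle point
gives another solution. -/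
theorem IsSolution.contract {n m : ℕ} {φ : Pt n m → ℝ} (hφ : Differentiable ℝ φ)
    (hcc : ConcaveConvex φ) {zb : Pt n m} (hzb : IsSaddle φ zb) {z : ℝ → Pt n m}
    (hz : IsSolution φ z) (hd : ∀ t, eDist (z t) zb = eDist (z 0) zb) {s : ℝ} (hs0 : 0 < s)
    (hs1 : s ≤ 1) : IsSolution φ fun t => zb + s • (z t - zb) := by
  intro t
  have h := hz.fderiv_eq_zero_of_eDist_const hd t
  have hx := fderiv_fst_segment hφ hcc.1 hcc.2 hzb h hs0 hs1
  have hy := fderiv_snd_segment hφ hcc.1 hcc.2 hzb h hs0 hs1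
  have hX : gradX φ (zb + s • (z t - zb)) = s • gradX φ (z t) := funext fun i => hx _
  have hY : gradY φ (zb + s • (z t - zb)) = s • gradY φ (z t) := funext fun j => hy _
  rw [hX, hY]
  have := (((hz t).sub_const zb).const_smul s).const_add zb
  simpa using this

theorem IsSaddle.isSolution_const {n m : ℕ} {φ : Pt n m → ℝ} (hφ : Differentiable ℝ φ)
    {w : Pt n m} (hw : IsSaddle φ w) : IsSolution φ fun _ => w := by
  intro t
  have hX : gradX φ w = 0 :=
    funext fun i => fderiv_fst_eq_zero_of_isMax hφ (fun v => (hw v w.2).1) _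
  have hY : gradY φ w = 0 :=
    funext fun j => fderiv_snd_eq_zero_of_isMin hφ (fun v => (hw w.1 v).2) _
  rw [hX, hY, neg_zero]
  exact hasDerivAt_const t w

/-- If a saddle point `zb` of a `C²` concave-convex `φ` is locally
asymptotically stable (Lyapunov stable plus locally attractive) for the gradient dynamics,
then `zb` is the unique saddle point and every trajectory in `𝒮` is constant at `zb`. -/
theorem asymptotically_stable_saddle_unique {n m : ℕ} (φ : Pt n m → ℝ)
    (hφ : ContDiff ℝ 2 φ) (hcc : ConcaveConvex φ)
    (zb : Pt n m) (hzb : IsSaddle φ zb)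
    (hstable : ∀ ε > (0 : ℝ), ∃ δ > (0 : ℝ), ∀ z : ℝ → Pt n m, IsSolution φ z →
      eDist (z 0) zb < δ → ∀ t ≥ (0 : ℝ), eDist (z t) zb < ε)
    (hattract : ∃ δ > (0 : ℝ), ∀ z : ℝ → Pt n m, IsSolution φ z →
      eDist (z 0) zb < δ →
      Filter.Tendsto (fun t => eDist (z t) zb) Filter.atTop (nhds 0)) :
    (∀ w : Pt n m, IsSaddle φ w → w = zb) ∧
      (∀ z : ℝ → Pt n m, InS φ z → ∀ t, z t = zb) := by
  have hd : Differentiable ℝ φ := hφ.differentiable (by norm_num)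
  have hS : ∀ z : ℝ → Pt n m, InS φ z → ∀ t, z t = zb := by
    intro z hz t
    obtain ⟨δ, hδ, hconv⟩ := hattract
    have hconst := hz.2 zb hzb
    have hr : 0 ≤ eDist (z 0) zb := Real.sqrt_nonneg _
    obtain ⟨s, hs0, hs1, hsδ⟩ : ∃ s : ℝ, 0 < s ∧ s ≤ 1 ∧ s * eDist (z 0) zb < δ := by
      refine ⟨δ / (δ + eDist (z 0) zb), by positivity, ?_, ?_⟩
      · rw [div_le_one (by positivity)]
        linarith
      · rw [div_mul_eq_mul_div, div_lt_iff₀ (by positivity)]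
        nlinarith
    have hlim := hconv _ (hz.1.contract hd hcc hzb hconst hs0 hs1)
      (by rwa [eDist_add_smul_sub _ _ hs0.le])
    simp only [eDist_add_smul_sub _ _ hs0.le, hconst] at hlim
    have h0 := tendsto_nhds_unique hlim tendsto_const_nhds
    refine eq_of_eDist_eq_zero ((hconst t).trans ?_)
    exact (mul_eq_zero.1 h0.symm).resolve_left hs0.ne'
  exact ⟨fun w hw => hS _ ⟨hw.isSolution_const hd, fun _ _ _ => rfl⟩ 0, hS⟩
end
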